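/- arXiv:1903.09717 — 13 statements merged into one kernel-verified Lean document; each statement's English description precedes it below -/
import Mathlib

section
/- Let Q = (V,E) be an acyclic hypergraph with E nonempty and ∪E = V. Then the minimum of Σ_{e∈E} w(e) over all fractional edge covers w : E → ℝ≥0 (i.e., Σ_{e : v∈e} w(e) ≥ 1 for every v ∈ V) equals the minimum cardinality of a subset C ⊆ E with ∪C = V. In particular, the fractional edge cover number of an acyclic hypergraph is an integer. -/
open Finset

/-- A join tree for a hypergraph `(V, E)`: a tree whose nodes are in one-to-one
correspondence with the hyperedges of `E` such that, for every vertex `v`, the nodes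
corresponding to hyperedges containing `v` induce a connected subtree. -/
def IsJoinTree {V : Type} (E : Finset (Finset V)) (T : SimpleGraph {e // e ∈ E}) : Prop :=
  T.IsTree ∧ ∀ v : V, (T.induce {e : {e // e ∈ E} | v ∈ e.1}).Preconnected

/-- A hypergraph is acyclic if it has a join tree. -/
def AcyclicHG {V : Type} (E : Finset (Finset V)) : Prop :=
  ∃ T : SimpleGraph {e // e ∈ E}, IsJoinTree E T

lemma geod_aux {W : Type} {T : SimpleGraph W} {b r c : W} (g : T.Walk b r)
    (hg : g.length = T.dist b r) (hc : c ∈ g.support) : c = b ∨ T.dist c r < T.dist b r := by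
  classical
  have h1 := congrArg SimpleGraph.Walk.length (g.take_spec hc)
  rw [SimpleGraph.Walk.length_append] at h1
  have h2 := SimpleGraph.dist_le (g.dropUntil c hc)
  by_cases h0 : (g.takeUntil c hc).length = 0
  · left
    exact (SimpleGraph.Walk.eq_of_length_eq_zero h0).symm
  · right
    omega

lemma path_aux {W : Type} {T : SimpleGraph W} (hT : T.IsTree) (r : W) (S : Set W)
    (hS : (T.induce S).Preconnected) (a x : W) (ha : a ∈ S) (hx : x ∈ S)
    (hmin : ∀ y ∈ S, T.dist a r ≤ T.dist y r) :
    ∃ p : T.Walk x r, p.IsPath ∧ a ∈ p.support ∧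
      ∀ c ∈ p.support, c ∈ S ∨ T.dist c r < T.dist a r := by
  classical
  obtain ⟨q0, hq0⟩ := (hS ⟨x, hx⟩ ⟨a, ha⟩).exists_isPath
  obtain ⟨q, hq, hqS⟩ : ∃ q : T.Walk x a, q.IsPath ∧ ∀ c ∈ q.support, c ∈ S := by
    refine ⟨q0.map (SimpleGraph.Embedding.induce S).toHom,
      SimpleGraph.Walk.IsPath.map Subtype.val_injective hq0, ?_⟩
    intro c hc
    replace hc := (congrArg (c ∈ ·) (SimpleGraph.Walk.support_map (SimpleGraph.Embedding.induce S).toHom q0)).mp hc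
    obtain ⟨y, _, rfl⟩ := List.mem_map.1 hc
    exact y.2
  obtain ⟨g, hgp, hg⟩ := hT.1.exists_path_of_dist a r
  refine ⟨q.append g, ?_, ?_, ?_⟩
  · rw [SimpleGraph.Walk.isPath_def, SimpleGraph.Walk.support_append, List.nodup_append]
    have hn := hgp.support_nodup
    rw [← SimpleGraph.Walk.cons_tail_support] at hn
    refine ⟨hq.support_nodup, (List.nodup_cons.1 hn).2, ?_⟩
    rintro c hc d hd rfl
    rcases geod_aux g hg (List.mem_of_mem_tail hd) with h | h
    · subst h
      exact (List.nodup_cons.1 hn).1 hd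
    · exact absurd (hmin c (hqS c hc)) (by omega)
  · simp
  · intro c hc
    rcases SimpleGraph.Walk.mem_support_append_iff _ _ |>.1 hc with h | h
    · exact Or.inl (hqS c h)
    · rcases geod_aux g hg h with h | h
      · exact Or.inl (h ▸ ha)
      · exact Or.inr h

lemma tops {V : Type} (E : Finset (Finset V)) (hE : E.Nonempty)
    (hcover : ∀ v : V, ∃ e ∈ E, v ∈ e) (hacyc : AcyclicHG E) :
    ∃ (t : V → Finset V) (d : V → ℕ), (∀ v, t v ∈ E ∧ v ∈ t v) ∧
      ∀ u v, ∀ e ∈ E, u ∈ e → v ∈ e → d u ≤ d v → u ∈ t v := by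
  classical
  obtain ⟨T, hT, hJ⟩ := hacyc
  obtain ⟨r0, hr0⟩ := hE
  let r : {e // e ∈ E} := ⟨r0, hr0⟩
  have h : ∀ v : V, ∃ a : {e // e ∈ E}, v ∈ a.1 ∧
      ∀ y : {e // e ∈ E}, v ∈ y.1 → T.dist a r ≤ T.dist y r := by
    intro v
    obtain ⟨e, he, hv⟩ := hcover v
    obtain ⟨a, ha, hm⟩ := Finset.exists_min_image
      (Finset.univ.filter (fun y : {e // e ∈ E} => v ∈ y.1)) (fun y => T.dist y r)
      ⟨⟨e, he⟩, by simpa using hv⟩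
    exact ⟨a, by simpa using ha, fun y hy => hm y (by simpa using hy)⟩
  choose t ht hm using h
  refine ⟨fun v => (t v).1, fun v => T.dist (t v) r, fun v => ⟨(t v).2, ht v⟩, ?_⟩
  intro u v e he hu hv hd
  obtain ⟨p, hp, hpa, -⟩ := path_aux hT r {e | v ∈ e.1} (hJ v) (t v) ⟨e, he⟩ (ht v) hv (hm v)
  obtain ⟨p', hp', -, hS⟩ := path_aux hT r {e | u ∈ e.1} (hJ u) (t u) ⟨e, he⟩ (ht u) hu (hm u)
  have hpp : p = p' := (hT.existsUnique_path _ _).unique hp hp'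
  subst hpp
  rcases hS _ hpa with h | h
  · exact h
  · exact absurd hd (not_le.2 h)

lemma greedy {V : Type} [DecidableEq V] (E : Finset (Finset V))
    (t : V → Finset V) (d : V → ℕ) (ht : ∀ v, t v ∈ E ∧ v ∈ t v)
    (h : ∀ u v, ∀ e ∈ E, u ∈ e → v ∈ e → d u ≤ d v → u ∈ t v) (S : Finset V) :
    ∃ (C : Finset (Finset V)) (I : Finset V), C ⊆ E ∧ I ⊆ S ∧ (∀ v ∈ S, ∃ e ∈ C, v ∈ e) ∧
      C.card ≤ I.card ∧ ∀ u ∈ I, ∀ v ∈ I, ∀ e ∈ E, u ∈ e → v ∈ e → u = v := by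
  induction S using Finset.strongInduction with
  | H S ih =>
    rcases S.eq_empty_or_nonempty with rfl | hS
    · exact ⟨∅, ∅, by simp⟩
    obtain ⟨v, hv, hmax⟩ := S.exists_max_image d hS
    obtain ⟨C, I, hC, hI, hcov, hcard, hind⟩ := ih (S.filter (fun u => u ∉ t v)) (by
      refine Finset.filter_ssubset.2 ⟨v, hv, by simpa using (ht v).2⟩)
    have key : ∀ u ∈ I, ∀ e ∈ E, u ∈ e → v ∈ e → False := by
      intro u hu e he hue hve
      have := Finset.mem_filter.1 (hI hu)
      exact this.2 (h u v e he hue hve (hmax u this.1))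
    refine ⟨insert (t v) C, insert v I, ?_, ?_, ?_, ?_, ?_⟩
    · exact Finset.insert_subset (ht v).1 hC
    · exact Finset.insert_subset hv (hI.trans (Finset.filter_subset _ _))
    · intro u hu
      by_cases hut : u ∈ t v
      · exact ⟨t v, Finset.mem_insert_self _ _, hut⟩
      · obtain ⟨e, he, hue⟩ := hcov u (Finset.mem_filter.2 ⟨hu, hut⟩)
        exact ⟨e, Finset.mem_insert_of_mem he, hue⟩
    · have hvI : v ∉ I := fun hvI => (Finset.mem_filter.1 (hI hvI)).2 (ht v).2
      rw [Finset.card_insert_of_notMem hvI]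
      exact (Finset.card_insert_le _ _).trans (by omega)
    · intro a ha b hb e he hae hbe
      rcases Finset.mem_insert.1 ha with rfl | ha'
      · rcases Finset.mem_insert.1 hb with rfl | hb
        · rfl
        · exact (key b hb e he hbe hae).elim
      · rcases Finset.mem_insert.1 hb with rfl | hb
        · exact (key a ha' e he hae hbe).elim
        · exact hind a ha' b hb e he hae hbe

theorem stmt2 {V : Type} [Fintype V] [DecidableEq V] (E : Finset (Finset V))
    (hE : E.Nonempty) (hcover : ∀ v : V, ∃ e ∈ E, v ∈ e) (hacyc : AcyclicHG E) :
    sInf {x : ℝ | ∃ w : Finset V → ℝ, (∀ e, 0 ≤ w e) ∧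
        (∀ v : V, 1 ≤ ∑ e ∈ E.filter (fun e => v ∈ e), w e) ∧ x = ∑ e ∈ E, w e}
      = sInf {x : ℝ | ∃ C : Finset (Finset V), C ⊆ E ∧
          (∀ v : V, ∃ e ∈ C, v ∈ e) ∧ x = (C.card : ℝ)} := by
  obtain ⟨t, d, ht, h⟩ := tops E hE hcover hacyc
  obtain ⟨C, I, hC, -, hcov, hcard, hind⟩ := greedy E t d ht h Finset.univ
  have fromC : ∀ D : Finset (Finset V), D ⊆ E → (∀ v : V, ∃ e ∈ D, v ∈ e) →
      ∃ w : Finset V → ℝ, (∀ e, 0 ≤ w e) ∧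
        (∀ v : V, 1 ≤ ∑ e ∈ E.filter (fun e => v ∈ e), w e) ∧
        (D.card : ℝ) = ∑ e ∈ E, w e := by
    intro D hD hDc
    refine ⟨fun e => if e ∈ D then 1 else 0, ?_, ?_, ?_⟩
    · intro e
      dsimp only
      split_ifs <;> norm_num
    · intro v
      obtain ⟨e, he, hve⟩ := hDc v
      have := Finset.single_le_sum (s := E.filter (fun e => v ∈ e))
        (f := fun e => if e ∈ D then (1 : ℝ) else 0)
        (fun i _ => by split_ifs <;> norm_num)
        (Finset.mem_filter.2 ⟨hD he, hve⟩)
      simpa [he] using this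
    · rw [Finset.sum_ite_mem, Finset.inter_eq_right.2 hD]
      simp
  have lower : ∀ w : Finset V → ℝ, (∀ e, 0 ≤ w e) →
      (∀ v : V, 1 ≤ ∑ e ∈ E.filter (fun e => v ∈ e), w e) → (C.card : ℝ) ≤ ∑ e ∈ E, w e := by
    intro w hw hc
    calc (C.card : ℝ) ≤ I.card := by exact_mod_cast hcard
      _ = ∑ v ∈ I, (1 : ℝ) := by simp
      _ ≤ ∑ v ∈ I, ∑ e ∈ E.filter (fun e => v ∈ e), w e := Finset.sum_le_sum fun v _ => hc v
      _ = ∑ e ∈ I.biUnion (fun v => E.filter (fun e => v ∈ e)), w e := by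
        rw [Finset.sum_biUnion]
        intro u hu v hv huv
        refine Finset.disjoint_left.2 fun e he he' => huv ?_
        exact hind u hu v hv e (Finset.mem_filter.1 he).1 (Finset.mem_filter.1 he).2
          (Finset.mem_filter.1 he').2
      _ ≤ ∑ e ∈ E, w e := by
        refine Finset.sum_le_sum_of_subset_of_nonneg ?_ fun e _ _ => hw e
        exact Finset.biUnion_subset.2 fun v _ => Finset.filter_subset _ _
  have hCc : ∀ v : V, ∃ e ∈ C, v ∈ e := fun v => hcov v (Finset.mem_univ v)
  have h1 : IsLeast {x : ℝ | ∃ w : Finset V → ℝ, (∀ e, 0 ≤ w e) ∧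
        (∀ v : V, 1 ≤ ∑ e ∈ E.filter (fun e => v ∈ e), w e) ∧ x = ∑ e ∈ E, w e} C.card := by
    refine ⟨fromC C hC hCc, ?_⟩
    rintro x ⟨w, hw, hc, rfl⟩
    exact lower w hw hc
  have h2 : IsLeast {x : ℝ | ∃ C : Finset (Finset V), C ⊆ E ∧
          (∀ v : V, ∃ e ∈ C, v ∈ e) ∧ x = (C.card : ℝ)} C.card := by
    refine ⟨⟨C, hC, hCc, rfl⟩, ?_⟩
    rintro x ⟨D, hD, hDc, rfl⟩
    obtain ⟨w, hw, hc, hx⟩ := fromC D hD hDc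
    rw [hx]
    exact lower w hw hc
  rw [h1.csInf_eq, h2.csInf_eq]
end

section
/- An acyclic join Q = (V,E) is not r-hierarchical if and only if Q has a minimal path of length 3, i.e., a sequence (x1,x2,x3,x4) of four distinct attributes such that each consecutive pair {x_i, x_{i+1}} is contained in some hyperedge of E, but no hyperedge of E contains both x_i and x_j for any i, j with |i−j| > 1. -/
open Finset

/-- `E_x`: the set of hyperedges containing attribute `x`. -/
def edgesWith {V : Type} [DecidableEq V] (E : Finset (Finset V)) (x : V) :
    Finset (Finset V) := E.filter (fun e => x ∈ e)

/-- A hypergraph is hierarchical if for every pair of attributes `x, y`, either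
`E_x ⊆ E_y`, or `E_y ⊆ E_x`, or `E_x ∩ E_y = ∅`. -/
def Hierarchical {V : Type} [DecidableEq V] (E : Finset (Finset V)) : Prop :=
  ∀ x y : V, edgesWith E x ⊆ edgesWith E y ∨ edgesWith E y ⊆ edgesWith E x ∨
    edgesWith E x ∩ edgesWith E y = ∅

/-- The reduced hypergraph keeps exactly the inclusion-maximal hyperedges. -/
def reduceHG {V : Type} [DecidableEq V] (E : Finset (Finset V)) : Finset (Finset V) :=
  E.filter (fun e => ∀ e' ∈ E, e ⊆ e' → e = e')

/-- A hypergraph is r-hierarchical if its reduced hypergraph is hierarchical. -/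
def RHierarchical {V : Type} [DecidableEq V] (E : Finset (Finset V)) : Prop :=
  Hierarchical (reduceHG E)

theorem aux_induce_walk {α : Type} (T : SimpleGraph α) (C : Set α)
    (h : (T.induce C).Preconnected) {u v : α} (hu : u ∈ C) (hv : v ∈ C) :
    ∃ p : T.Walk u v, ∀ x ∈ p.support, x ∈ C := by
  obtain ⟨p⟩ := h ⟨u, hu⟩ ⟨v, hv⟩
  refine ⟨p.map (SimpleGraph.Embedding.induce C).toHom, ?_⟩
  intro x hx
  have hs := SimpleGraph.Walk.support_map (SimpleGraph.Embedding.induce C).toHom p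
  obtain ⟨y, -, rfl⟩ := List.mem_map.1 (Eq.mp (congrArg (x ∈ ·) hs) hx)
  exact y.2

theorem aux_gate {α : Type} (T : SimpleGraph α) (hT : T.IsTree) (S : Set α) (r s0 : α)
    (hs0 : s0 ∈ S)
    (hS : ∀ u ∈ S, ∀ v ∈ S, ∃ p : T.Walk u v, ∀ x ∈ p.support, x ∈ S) :
    ∃ t ∈ S, ∀ s ∈ S, ∀ q : T.Walk r s, t ∈ q.support := by
  classical
  have hex : ∃ n : ℕ, ∃ t ∈ S, ∃ p : T.Walk r t, p.length = n := by
    obtain ⟨p⟩ := hT.connected.preconnected r s0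
    exact ⟨_, s0, hs0, p, rfl⟩
  obtain ⟨t, ht, p, hp⟩ := Nat.find_spec hex
  have hmin : ∀ u ∈ S, ∀ q : T.Walk r u, p.length ≤ q.length := by
    intro u hu q
    rw [hp]
    exact Nat.find_min' hex ⟨u, hu, q, rfl⟩
  have hb : ∀ u ∈ S, u ∈ p.bypass.support → u = t := by
    intro u hu hup
    by_contra hne
    have h1 := SimpleGraph.Walk.length_takeUntil_lt hup hne
    have h2 := hmin u hu (p.bypass.takeUntil u hup)
    have h3 := p.length_bypass_le
    omega
  refine ⟨t, ht, ?_⟩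
  intro s hs q
  obtain ⟨w, hw⟩ := hS t ht s hs
  have hwp : w.bypass.IsPath := w.bypass_isPath
  have hpp : p.bypass.IsPath := p.bypass_isPath
  have happ : (p.bypass.append w.bypass).IsPath := by
    rw [SimpleGraph.Walk.isPath_def] at *
    rw [SimpleGraph.Walk.support_append, List.nodup_append']
    refine ⟨hpp, hwp.sublist (List.tail_sublist _), ?_⟩
    intro x hx hx'
    have hxS := hw x (w.support_bypass_subset (List.mem_of_mem_tail hx'))
    have := hb x hxS hx
    subst this
    rw [SimpleGraph.Walk.support_eq_cons] at hwp
    exact (List.nodup_cons.1 hwp).1 hx'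
  have hu := hT.IsAcyclic.path_unique ⟨_, happ⟩ ⟨_, q.bypass_isPath⟩
  have hu' := congrArg Subtype.val hu
  simp only at hu'
  apply q.support_bypass_subset
  rw [← hu']
  simp [SimpleGraph.Walk.mem_support_append_iff]

theorem aux_sub {V : Type} [DecidableEq V] (E : Finset (Finset V)) (e : Finset V)
    (he : e ∈ reduceHG E) : e ∈ E := by
  rw [reduceHG, Finset.mem_filter] at he
  exact he.1

theorem aux_max {V : Type} [DecidableEq V] (E : Finset (Finset V)) (e : Finset V) (he : e ∈ E) :
    ∃ f ∈ reduceHG E, e ⊆ f := by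
  obtain ⟨f, hef, hf⟩ := E.exists_le_maximal he
  refine ⟨f, ?_, hef⟩
  rw [reduceHG, Finset.mem_filter]
  exact ⟨hf.prop, fun g hg hfg => hf.eq_of_le hg hfg⟩

/-- gate for an attribute y from edge r -/
theorem aux_gate2 {V : Type} (E : Finset (Finset V)) (T : SimpleGraph {e // e ∈ E})
    (hT : IsJoinTree E T) (y : V) (r s0 : {e // e ∈ E}) (hs0 : y ∈ s0.1) :
    ∃ t : {e // e ∈ E}, y ∈ t.1 ∧
      ∀ s : {e // e ∈ E}, y ∈ s.1 → ∀ q : T.Walk r s, t ∈ q.support :=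
  aux_gate T hT.1 {e | y ∈ e.1} r s0 hs0
    (fun _ hu _ hv => aux_induce_walk T _ (hT.2 y) hu hv)

/-- a maximal edge not containing y has an element not adjacent to y -/
theorem aux_nonadj {V : Type} [DecidableEq V] (E : Finset (Finset V)) (hacyc : AcyclicHG E)
    (e : Finset V) (he : e ∈ reduceHG E) (y : V) (hy : y ∉ e) (hcov : ∃ f ∈ E, y ∈ f) :
    ∃ a ∈ e, ∀ f ∈ E, ¬ (a ∈ f ∧ y ∈ f) := by
  by_contra! hcon
  obtain ⟨T, hT⟩ := hacyc
  obtain ⟨f0, hf0, hyf0⟩ := hcov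
  rw [reduceHG, Finset.mem_filter] at he
  obtain ⟨t, hyt, ht⟩ := aux_gate2 E T hT y ⟨e, he.1⟩ ⟨f0, hf0⟩ hyf0
  apply hy
  rw [he.2 t.1 t.2 ?_]
  · exact hyt
  intro a ha
  obtain ⟨f, hf, haf, hyf⟩ := hcon a ha
  obtain ⟨q, hq⟩ := aux_induce_walk T _ (hT.2 a) (u := ⟨e, he.1⟩) (v := ⟨f, hf⟩) ha haf
  exact hq t (ht _ hyf q)

theorem aux_cycle {V : Type} (E : Finset (Finset V)) (hacyc : AcyclicHG E)
    (a x y b : V) (h1 : ∃ e ∈ E, a ∈ e ∧ x ∈ e) (h2 : ∃ e ∈ E, x ∈ e ∧ y ∈ e)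
    (h3 : ∃ e ∈ E, y ∈ e ∧ b ∈ e) (h4 : ∃ e ∈ E, a ∈ e ∧ b ∈ e)
    (hay : ∀ f ∈ E, ¬ (a ∈ f ∧ y ∈ f)) (hxb : ∀ f ∈ E, ¬ (x ∈ f ∧ b ∈ f)) : False := by
  obtain ⟨T, hT⟩ := hacyc
  obtain ⟨e1, he1, ha1, hx1⟩ := h1
  obtain ⟨e2, he2, hx2, hy2⟩ := h2
  obtain ⟨e3, he3, hy3, hb3⟩ := h3
  obtain ⟨e4, he4, ha4, hb4⟩ := h4
  obtain ⟨t, hyt, ht⟩ := aux_gate2 E T hT y ⟨e1, he1⟩ ⟨e2, he2⟩ hy2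
  obtain ⟨p, hp⟩ := aux_induce_walk T _ (hT.2 x) (u := ⟨e1, he1⟩) (v := ⟨e2, he2⟩) hx1 hx2
  obtain ⟨q, hq⟩ := aux_induce_walk T _ (hT.2 a) (u := ⟨e1, he1⟩) (v := ⟨e4, he4⟩) ha1 ha4
  obtain ⟨w, hw⟩ := aux_induce_walk T _ (hT.2 b) (u := ⟨e4, he4⟩) (v := ⟨e3, he3⟩) hb4 hb3
  have hxt : x ∈ t.1 := hp t (ht _ hy2 p)
  have := ht _ hy3 (q.append w)
  rw [SimpleGraph.Walk.mem_support_append_iff] at this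
  rcases this with h | h
  · exact hay t.1 t.2 ⟨hq t h, hyt⟩
  · exact hxb t.1 t.2 ⟨hxt, hw t h⟩

/-- An acyclic join is not r-hierarchical iff it has a minimal path of length 3. -/
theorem stmt3 {V : Type} [Fintype V] [DecidableEq V] (E : Finset (Finset V))
    (hcover : ∀ v : V, ∃ e ∈ E, v ∈ e) (hacyc : AcyclicHG E) :
    ¬ RHierarchical E ↔
      ∃ x₁ x₂ x₃ x₄ : V,
        x₁ ≠ x₂ ∧ x₁ ≠ x₃ ∧ x₁ ≠ x₄ ∧ x₂ ≠ x₃ ∧ x₂ ≠ x₄ ∧ x₃ ≠ x₄ ∧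
        (∃ e ∈ E, x₁ ∈ e ∧ x₂ ∈ e) ∧ (∃ e ∈ E, x₂ ∈ e ∧ x₃ ∈ e) ∧
        (∃ e ∈ E, x₃ ∈ e ∧ x₄ ∈ e) ∧
        (∀ e ∈ E, ¬(x₁ ∈ e ∧ x₃ ∈ e)) ∧ (∀ e ∈ E, ¬(x₁ ∈ e ∧ x₄ ∈ e)) ∧
        (∀ e ∈ E, ¬(x₂ ∈ e ∧ x₄ ∈ e)) := by
  constructor
  · intro h
    unfold RHierarchical Hierarchical at h
    push Not at h
    obtain ⟨x, y, hxy, hyx, hne⟩ := h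
    obtain ⟨e1, h1, h1'⟩ := Finset.not_subset.1 hxy
    obtain ⟨e3, h3, h3'⟩ := Finset.not_subset.1 hyx
    obtain ⟨e2, h2⟩ := hne
    simp only [edgesWith, Finset.mem_inter, Finset.mem_filter, not_and] at h1 h1' h3 h3' h2
    have hsub : ∀ e ∈ reduceHG E, e ∈ E := fun e he => aux_sub E e he
    have hy1 := h1' h1.1
    have hx3 := h3' h3.1
    obtain ⟨a, ha, hay⟩ := aux_nonadj E hacyc e1 h1.1 y hy1 (hcover y)
    obtain ⟨b, hb, hbx⟩ := aux_nonadj E hacyc e3 h3.1 x hx3 (hcover x)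
    have e1E := hsub _ h1.1
    have e2E := hsub _ h2.1.1
    have e3E := hsub _ h3.1
    have hxb : ∀ f ∈ E, ¬ (x ∈ f ∧ b ∈ f) := fun f hf hh => hbx f hf hh.symm
    refine ⟨a, x, y, b, ?_, ?_, ?_, ?_, ?_, ?_, ⟨e1, e1E, ha, h1.2⟩, ⟨e2, e2E, h2.1.2, h2.2.2⟩,
      ⟨e3, e3E, h3.2, hb⟩, hay, ?_, hxb⟩
    · rintro rfl; exact hay e2 e2E ⟨h2.1.2, h2.2.2⟩
    · rintro rfl; exact hy1 ha
    · rintro rfl; exact hbx e1 e1E ⟨ha, h1.2⟩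
    · rintro rfl; exact hy1 h1.2
    · rintro rfl; exact hx3 hb
    · rintro rfl; exact hbx e2 e2E ⟨h2.2.2, h2.1.2⟩
    · intro f hf hh
      exact aux_cycle E hacyc a x y b ⟨e1, e1E, ha, h1.2⟩ ⟨e2, e2E, h2.1.2, h2.2.2⟩
        ⟨e3, e3E, h3.2, hb⟩ ⟨f, hf, hh⟩ hay hxb
  · rintro ⟨a, x, y, b, -, -, -, -, -, -, ⟨e1, h1, ha1, hx1⟩, ⟨e2, h2, hx2, hy2⟩,
      ⟨e3, h3, hy3, hb3⟩, hay, -, hxb⟩ hR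
    obtain ⟨f1, hf1, hs1⟩ := aux_max E e1 h1
    obtain ⟨f2, hf2, hs2⟩ := aux_max E e2 h2
    obtain ⟨f3, hf3, hs3⟩ := aux_max E e3 h3
    have hsub : ∀ e ∈ reduceHG E, e ∈ E := fun e he => aux_sub E e he
    rcases hR x y with h | h | h
    · have := h (Finset.mem_filter.2 ⟨hf1, hs1 hx1⟩)
      exact hay f1 (hsub _ hf1) ⟨hs1 ha1, (Finset.mem_filter.1 this).2⟩
    · have := h (Finset.mem_filter.2 ⟨hf3, hs3 hy3⟩)
      exact hxb f3 (hsub _ hf3) ⟨(Finset.mem_filter.1 this).2, hs3 hb3⟩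
    · have : f2 ∈ edgesWith (reduceHG E) x ∩ edgesWith (reduceHG E) y :=
        Finset.mem_inter.2 ⟨Finset.mem_filter.2 ⟨hf2, hs2 hx2⟩,
          Finset.mem_filter.2 ⟨hf2, hs2 hy2⟩⟩
      rw [h] at this
      exact absurd this (Finset.notMem_empty _)
end

section
/- Let Q = (V,E) be an acyclic hypergraph and let e_xy, e_xz, e_yz ∈ E be three distinct hyperedges with (e_xy ∩ e_xz) ∖ e_yz ≠ ∅, (e_xy ∩ e_yz) ∖ e_xz ≠ ∅, and (e_xz ∩ e_yz) ∖ e_xy ≠ ∅. Then there exists a hyperedge e ∈ E such that e_xy ∩ e_xz ⊆ e, e_xz ∩ e_yz ⊆ e, and e_xy ∩ e_yz ⊆ e. -/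
theorem stmt4_append_isPath {α : Type} {G : SimpleGraph α} {u v w : α} {p : G.Walk u v}
    {q : G.Walk v w} (hp : p.IsPath) (hq : q.IsPath)
    (h : ∀ t ∈ q.support, t ∈ p.support → t = v) : (p.append q).IsPath := by
  rw [SimpleGraph.Walk.isPath_def, SimpleGraph.Walk.support_append]
  have hq' := hq.support_nodup
  rw [SimpleGraph.Walk.support_eq_cons, List.nodup_cons] at hq'
  refine List.Nodup.append hp.support_nodup hq'.2 ?_
  intro t ht ht'
  have := h t (List.mem_of_mem_tail ht') ht
  subst this
  exact hq'.1 ht'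

theorem stmt4_path_mem {α : Type} {G : SimpleGraph α} (hG : G.IsAcyclic) (S : Set α)
    (hS : (G.induce S).Preconnected) {a b : α} (ha : a ∈ S) (hb : b ∈ S)
    (p : G.Walk a b) (hp : p.IsPath) : ∀ m ∈ p.support, m ∈ S := by
  classical
  obtain ⟨w, hw⟩ := (hS ⟨a, ha⟩ ⟨b, hb⟩).exists_isPath
  let f := (SimpleGraph.Embedding.induce (G := G) S)
  have hw' : (w.map f.toHom).IsPath := SimpleGraph.Walk.map_isPath_of_injective f.injective hw
  have h := hG.path_unique ⟨p, hp⟩ ⟨_, hw'⟩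
  have h' : p = w.map f.toHom := congrArg Subtype.val h
  intro m hm
  rw [h'] at hm
  have hm2 : m ∈ w.support.map f.toHom :=
    (SimpleGraph.Walk.support_map f.toHom w) ▸ hm
  obtain ⟨x, -, rfl⟩ := List.mem_map.1 hm2
  exact x.2

theorem stmt4_median {α : Type} {G : SimpleGraph α} (hG : G.IsTree) (a b c : α) :
    ∃ m, (∃ p : G.Walk a b, p.IsPath ∧ m ∈ p.support) ∧
      (∃ p : G.Walk c a, p.IsPath ∧ m ∈ p.support) ∧
      (∃ p : G.Walk c b, p.IsPath ∧ m ∈ p.support) := by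
  classical
  obtain ⟨p, hp⟩ := (hG.connected a b).exists_isPath
  obtain ⟨q, hq⟩ := (hG.connected c a).exists_isPath
  obtain ⟨m, hm, hmq, h⟩ := q.exists_mem_support_forall_mem_support_imp_eq p.support.toFinset
    ⟨a, by simp⟩
  have hm : m ∈ p.support := by simpa using hm
  refine ⟨m, ⟨p, hp, hm⟩, ⟨q, hq, hmq⟩,
    ⟨(q.takeUntil m hmq).append (p.dropUntil m hm), ?_, by simp⟩⟩
  refine stmt4_append_isPath (hq.takeUntil _) (hp.dropUntil _) ?_
  intro t ht ht'
  exact h t (by simpa using p.support_dropUntil_subset_support hm ht) ht'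

theorem stmt4 {V : Type} [Fintype V] [DecidableEq V] (E : Finset (Finset V))
    (hacyc : AcyclicHG E)
    (exy exz eyz : Finset V) (hxy : exy ∈ E) (hxz : exz ∈ E) (hyz : eyz ∈ E)
    (hne1 : exy ≠ exz) (hne2 : exy ≠ eyz) (hne3 : exz ≠ eyz)
    (h1 : ((exy ∩ exz) \ eyz).Nonempty)
    (h2 : ((exy ∩ eyz) \ exz).Nonempty)
    (h3 : ((exz ∩ eyz) \ exy).Nonempty) :
    ∃ e ∈ E, exy ∩ exz ⊆ e ∧ exz ∩ eyz ⊆ e ∧ exy ∩ eyz ⊆ e := by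
  obtain ⟨T, hT, hc⟩ := hacyc
  obtain ⟨m, ⟨p, hp, hmp⟩, ⟨q, hq, hmq⟩, ⟨r, hr, hmr⟩⟩ :=
    stmt4_median hT ⟨exy, hxy⟩ ⟨exz, hxz⟩ ⟨eyz, hyz⟩
  refine ⟨m.1, m.2, ?_, ?_, ?_⟩
  · intro v hv
    rw [Finset.mem_inter] at hv
    exact stmt4_path_mem hT.isAcyclic _ (hc v) hv.1 hv.2 p hp m hmp
  · intro v hv
    rw [Finset.mem_inter] at hv
    exact stmt4_path_mem hT.isAcyclic _ (hc v) hv.2 hv.1 r hr m hmr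
  · intro v hv
    rw [Finset.mem_inter] at hv
    exact stmt4_path_mem hT.isAcyclic _ (hc v) hv.2 hv.1 q hq m hmq
end

section
/- Let Q = (V,E) be an acyclic hypergraph, let e_xy, e_xz ∈ E be two distinct hyperedges, and let E_yz be a nonempty subset of E ∖ {e_xy, e_xz}. Suppose that for every e_yz ∈ E_yz both (e_xy ∩ e_xz) ∖ e_yz ≠ ∅ and (e_xy ∩ e_yz) ∖ e_xz ≠ ∅ hold, and that (∩_{e_yz ∈ E_yz} (e_xz ∩ e_yz)) ∖ e_xy ≠ ∅. Then there exists a hyperedge e ∈ E such that e_xy ∩ e_xz ⊆ e, ∪_{e_yz ∈ E_yz} (e_xy ∩ e_yz) ⊆ e, and ∩_{e_yz ∈ E_yz} (e_xz ∩ e_yz) ⊆ e. -/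
theorem aux_median {α : Type*} (T : SimpleGraph α) (hT : T.IsAcyclic) {a b : α}
    (p : T.Walk a b) (hp : p.IsPath) (C : Set α) (hC : C.Nonempty) :
    ∃ x, (∃ q : T.Walk a b, q.IsPath ∧ x ∈ q.support) ∧
      (∀ c ∈ C, ∀ q : T.Walk a c, q.IsPath → x ∈ q.support) ∧
      (∃ c ∈ C, ∀ q : T.Walk b c, q.IsPath → x ∈ q.support) := by
  classical
  induction p with
  | nil =>
    rename_i u
    obtain ⟨c, hc⟩ := hC
    exact ⟨u, ⟨.nil, by simp, by simp⟩, fun c _ q _ => q.start_mem_support,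
      c, hc, fun q _ => q.start_mem_support⟩
  | cons h p ih =>
    rename_i u v w
    by_cases hu : ∃ c ∈ C, ∀ q : T.Walk w c, q.IsPath → u ∈ q.support
    · exact ⟨u, ⟨.cons h p, hp, by simp⟩, fun c _ q _ => q.start_mem_support, hu⟩
    · push Not at hu
      rw [SimpleGraph.Walk.cons_isPath_iff] at hp
      obtain ⟨x, ⟨q, hq, hxq⟩, h2, h3⟩ := ih hp.1
      refine ⟨x, ⟨.cons h p, ?_, ?_⟩, ?_, h3⟩
      · rw [SimpleGraph.Walk.cons_isPath_iff]; exact hp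
      · have := congrArg Subtype.val (hT.path_unique ⟨q, hq⟩ ⟨p, hp.1⟩)
        simp only at this
        subst this
        simp [hxq]
      · intro c hc r hr
        obtain ⟨s, hs, hus⟩ := hu c hc
        have hun : u ∉ (p.append s).bypass.support := by
          intro hmem
          have := SimpleGraph.Walk.support_bypass_subset_support _ hmem
          rw [SimpleGraph.Walk.mem_support_append_iff] at this
          exact this.elim hp.2 hus
        have hpath : (SimpleGraph.Walk.cons h (p.append s).bypass).IsPath := by
          rw [SimpleGraph.Walk.cons_isPath_iff]
          exact ⟨SimpleGraph.Walk.bypass_isPath _, hun⟩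
        have := congrArg Subtype.val (hT.path_unique ⟨r, hr⟩ ⟨_, hpath⟩)
        simp only at this
        subst this
        have := h2 c hc _ (SimpleGraph.Walk.bypass_isPath (p.append s))
        simp [this]

theorem aux_path {V : Type} {E : Finset (Finset V)} {T : SimpleGraph {e // e ∈ E}}
    (hT : IsJoinTree E T) (a b : {e // e ∈ E}) (v : V) (ha : v ∈ a.1) (hb : v ∈ b.1) :
    ∃ q : T.Walk a b, q.IsPath ∧ ∀ x ∈ q.support, v ∈ x.1 := by
  classical
  obtain ⟨w⟩ := hT.2 v ⟨a, ha⟩ ⟨b, hb⟩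
  let w' : T.Walk a b := w.map (SimpleGraph.Embedding.induce _).toHom
  refine ⟨w'.bypass, SimpleGraph.Walk.bypass_isPath _, fun x hx => ?_⟩
  have := SimpleGraph.Walk.support_bypass_subset_support _ hx
  have hs : w'.support = w.support.map (SimpleGraph.Embedding.induce _).toHom :=
    SimpleGraph.Walk.support_map _ _
  rw [hs, List.mem_map] at this
  obtain ⟨y, _, rfl⟩ := this
  exact y.2

theorem stmt5 {V : Type} [Fintype V] [DecidableEq V] (E : Finset (Finset V))
    (hacyc : AcyclicHG E)
    (exy exz : Finset V) (hxy : exy ∈ E) (hxz : exz ∈ E) (hne : exy ≠ exz)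
    (Eyz : Finset (Finset V)) (hEyz : Eyz ⊆ E) (hne1 : exy ∉ Eyz) (hne2 : exz ∉ Eyz)
    (hEne : Eyz.Nonempty)
    (h1 : ∀ eyz ∈ Eyz, ((exy ∩ exz) \ eyz).Nonempty)
    (h2 : ∀ eyz ∈ Eyz, ((exy ∩ eyz) \ exz).Nonempty)
    (h3 : ((Eyz.inf' hEne (fun eyz => exz ∩ eyz)) \ exy).Nonempty) :
    ∃ e ∈ E, exy ∩ exz ⊆ e ∧ (∀ eyz ∈ Eyz, exy ∩ eyz ⊆ e) ∧
      Eyz.inf' hEne (fun eyz => exz ∩ eyz) ⊆ e := by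
  obtain ⟨T, hT⟩ := hacyc
  obtain ⟨p, hp, -⟩ := hT.1.existsUnique_path ⟨exy, hxy⟩ ⟨exz, hxz⟩
  obtain ⟨x, ⟨q, hq, hxq⟩, hx2, c, hc, hx3⟩ := aux_median T hT.1.isAcyclic p hp
    {c | c.1 ∈ Eyz} (by
      obtain ⟨c, hc⟩ := hEne
      exact ⟨⟨c, hEyz hc⟩, hc⟩)
  refine ⟨x.1, x.2, ?_, ?_, ?_⟩
  · intro v hv
    rw [Finset.mem_inter] at hv
    obtain ⟨r, hr, hrv⟩ := aux_path hT ⟨exy, hxy⟩ ⟨exz, hxz⟩ v hv.1 hv.2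
    have := congrArg Subtype.val (hT.1.isAcyclic.path_unique ⟨q, hq⟩ ⟨r, hr⟩)
    simp only at this
    subst this
    exact hrv x hxq
  · intro d hd v hv
    rw [Finset.mem_inter] at hv
    obtain ⟨r, hr, hrv⟩ := aux_path hT ⟨exy, hxy⟩ ⟨d, hEyz hd⟩ v hv.1 hv.2
    exact hrv x (hx2 ⟨d, hEyz hd⟩ hd r hr)
  · intro v hv
    have hle := Finset.inf'_le (fun eyz => exz ∩ eyz) hc hv
    rw [Finset.mem_inter] at hle
    obtain ⟨r, hr, hrv⟩ := aux_path hT ⟨exz, hxz⟩ c v hle.1 hle.2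
    exact hrv x (hx3 r hr)
end

section
/- Let A, B, C be finite sets with |A| = τ ≥ 1, let S ⊆ B × C, and let L be a positive integer with τ ≤ L and τ dividing L. For an integer w ≥ 0 let Δ(w) = max{ |S ∩ (U×V)| : U ⊆ B, V ⊆ C, |U| ≤ w, |V| ≤ w }. Let OPT₁ = max{ Σ_{a∈A} |S ∩ (U_a × V_a)| : U_a ⊆ B and V_a ⊆ C for each a ∈ A, Σ_{a∈A}|U_a| ≤ L, Σ_{a∈A}|V_a| ≤ L }, and let OPT₃ = max{ Σ_{a∈A} Δ(w_a) : w_a ∈ {0,1,…,L} for each a ∈ A, Σ_{a∈A} w_a ≤ 2L }. Let w* be a maximizer of (L/w)·Δ(w) over integers w with L/τ ≤ w ≤ L. Then OPT₁ ≤ OPT₃ ≤ 3·(L/w*)·Δ(w*). -/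
open Finset

/-- The exchange/covering argument for the triangle-join lower bound:
`OPT₁ ≤ OPT₃ ≤ 3 · (L/w*) · Δ(w*)`. -/
theorem stmt7 {α β γ : Type} [DecidableEq α] [DecidableEq β] [DecidableEq γ]
    (A : Finset α) (B : Finset β) (C : Finset γ) (S : Finset (β × γ))
    (hS : S ⊆ B ×ˢ C) (τ L : ℕ) (hτ : 1 ≤ τ) (hA : A.card = τ)
    (hL : 0 < L) (hτL : τ ≤ L) (hdvd : τ ∣ L)
    (Δ : ℕ → ℕ)
    (hΔ : ∀ w, Δ w = ((B.powerset ×ˢ C.powerset).filter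
        (fun UV => UV.1.card ≤ w ∧ UV.2.card ≤ w)).sup
        (fun UV => (S ∩ UV.1 ×ˢ UV.2).card))
    (wstar : ℕ) (hw1 : L / τ ≤ wstar) (hw2 : wstar ≤ L)
    (hwmax : ∀ w : ℕ, L / τ ≤ w → w ≤ L →
      (L : ℝ) / w * Δ w ≤ (L : ℝ) / wstar * Δ wstar)
    (OPT1 OPT3 : ℕ)
    (hOPT1 : OPT1 = sSup {n : ℕ | ∃ (U : α → Finset β) (W : α → Finset γ),
      (∀ a, U a ⊆ B) ∧ (∀ a, W a ⊆ C) ∧ (∑ a ∈ A, (U a).card) ≤ L ∧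
      (∑ a ∈ A, (W a).card) ≤ L ∧ n = ∑ a ∈ A, (S ∩ (U a ×ˢ W a)).card})
    (hOPT3 : OPT3 = sSup {n : ℕ | ∃ w : α → ℕ, (∀ a, w a ≤ L) ∧
      (∑ a ∈ A, w a) ≤ 2 * L ∧ n = ∑ a ∈ A, Δ (w a)}) :
    OPT1 ≤ OPT3 ∧ (OPT3 : ℝ) ≤ 3 * ((L : ℝ) / wstar * Δ wstar) := by
  have hle : ∀ w, Δ w ≤ S.card := by
    intro w
    rw [hΔ]
    apply Finset.sup_le
    intro UV _
    exact card_le_card inter_subset_left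
  have hge : ∀ w U V, U ⊆ B → V ⊆ C → U.card ≤ w → V.card ≤ w →
      (S ∩ U ×ˢ V).card ≤ Δ w := by
    intro w U V hU hV h1 h2
    rw [hΔ]
    exact Finset.le_sup (f := fun UV : Finset β × Finset γ => (S ∩ UV.1 ×ˢ UV.2).card)
      (b := (U, V)) (by simp [hU, hV, h1, h2])
  have hmono : ∀ v w, v ≤ w → Δ v ≤ Δ w := by
    intro v w hvw
    rw [hΔ v]
    apply Finset.sup_le
    intro UV h
    simp only [mem_filter, mem_product, mem_powerset] at h
    exact hge w _ _ h.1.1 h.1.2 (h.2.1.trans hvw) (h.2.2.trans hvw)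
  constructor
  · rw [hOPT1, hOPT3]
    apply csSup_le
    · exact ⟨_, fun _ => ∅, fun _ => ∅, by simp, by simp, by simp, by simp, rfl⟩
    · rintro n ⟨U, W, hU, hW, h1, h2, rfl⟩
      have hbdd : BddAbove {n : ℕ | ∃ w : α → ℕ, (∀ a, w a ≤ L) ∧
          (∑ a ∈ A, w a) ≤ 2 * L ∧ n = ∑ a ∈ A, Δ (w a)} := by
        refine ⟨∑ a ∈ A, S.card, ?_⟩
        rintro n ⟨w, _, _, rfl⟩
        exact sum_le_sum fun a _ => hle _
      let w : α → ℕ := fun a => if a ∈ A then max (U a).card (W a).card else 0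
      have hw : ∀ a ∈ A, w a = max (U a).card (W a).card := fun a ha => by simp [w, ha]
      refine le_trans (b := ∑ a ∈ A, Δ (w a)) ?_ (le_csSup hbdd ⟨w, ?_, ?_, rfl⟩)
      · refine sum_le_sum fun a ha => hge _ _ _ (hU a) (hW a) ?_ ?_ <;> rw [hw a ha] <;> simp
      · intro a
        by_cases ha : a ∈ A
        · rw [hw a ha]
          exact max_le
            ((single_le_sum (f := fun a => (U a).card) (fun _ _ => Nat.zero_le _) ha).trans h1)
            ((single_le_sum (f := fun a => (W a).card) (fun _ _ => Nat.zero_le _) ha).trans h2)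
        · simp [w, ha]
      · calc ∑ a ∈ A, w a ≤ ∑ a ∈ A, ((U a).card + (W a).card) :=
              sum_le_sum fun a ha => by rw [hw a ha]; omega
          _ ≤ 2 * L := by rw [sum_add_distrib]; omega
  · set M : ℝ := (L : ℝ) / wstar * Δ wstar with hM
    have hM0 : 0 ≤ M := by positivity
    have hq : 0 < L / τ := Nat.div_pos hτL hτ
    have hqτ : τ * (L / τ) = L := Nat.mul_div_cancel' hdvd
    generalize L / τ = q at *
    have hLr : (0 : ℝ) < L := by exact_mod_cast hL
    have key0 : ∀ w, q ≤ w → w ≤ L → (L : ℝ) * Δ w ≤ w * M := by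
      intro w h1 h2
      have h := hwmax w h1 h2
      have hwr : (0 : ℝ) < w := by exact_mod_cast (lt_of_lt_of_le hq h1)
      rw [div_mul_eq_mul_div, div_le_iff₀ hwr] at h
      linarith
    have hqL : q ≤ L := by nlinarith
    have key : ∀ w, w ≤ L → (L : ℝ) * Δ w ≤ (w + q) * M := by
      intro w h2
      have hwM : 0 ≤ (w : ℝ) * M := by positivity
      have hqM : 0 ≤ (q : ℝ) * M := by positivity
      rcases le_total q w with h | h
      · have := key0 w h h2
        linarith
      · have h3 := key0 q le_rfl hqL
        have h4 : (Δ w : ℝ) ≤ Δ q := by exact_mod_cast hmono w q h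
        have h5 : (L : ℝ) * Δ w ≤ L * Δ q := by gcongr
        linarith
    have hmem : OPT3 ∈ {n : ℕ | ∃ w : α → ℕ, (∀ a, w a ≤ L) ∧
      (∑ a ∈ A, w a) ≤ 2 * L ∧ n = ∑ a ∈ A, Δ (w a)} := by
      rw [hOPT3]
      apply Nat.sSup_mem
      · exact ⟨_, fun _ => 0, by simp, by simp, rfl⟩
      · refine ⟨∑ a ∈ A, S.card, ?_⟩
        rintro n ⟨w, _, _, rfl⟩
        exact sum_le_sum fun a _ => hle _
    obtain ⟨w, hwL, hsum, hn⟩ := hmem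
    have h1 : (L : ℝ) * OPT3 ≤ L * (3 * M) := by
      rw [hn]
      push_cast
      rw [mul_sum]
      calc ∑ a ∈ A, (L : ℝ) * Δ (w a) ≤ ∑ a ∈ A, ((w a : ℝ) + q) * M :=
            sum_le_sum fun a _ => key _ (hwL a)
        _ = ((∑ a ∈ A, w a : ℕ) + (τ * q : ℕ) : ℝ) * M := by
            rw [← sum_mul, sum_add_distrib]
            simp [hA]
        _ ≤ ((2 * L : ℕ) + (L : ℕ) : ℝ) * M := by
            rw [hqτ]
            gcongr
        _ = L * (3 * M) := by push_cast; ring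
    exact le_of_mul_le_mul_left h1 hLr
end

section
/- There exist absolute constants c > 0 and N₀ such that for all integers N ≥ N₀, τ, and L with 1 ≤ τ, τ² ≤ N, τ dividing N, τ dividing L, and τ ≤ L ≤ N, there exists a set S ⊆ {1,…,N/τ} × {1,…,N/τ} with N/2 ≤ |S| ≤ 2N such that for all subsets X, Y ⊆ {1,…,N/τ} with |X| = |Y| = L/τ, one has |S ∩ (X × Y)| ≤ c · max{ (L/τ)·log N , L²/N }. -/
open Finset

def ptS (m : ℕ) {n τ : ℕ} (p : Fin n × Fin τ) (v : Fin m) : ℕ × ℕ :=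
  (p.1.1 + 1, p.2.1 * m + v.1 + 1)

lemma ptS_inj (m : ℕ) {n τ : ℕ} (p q : Fin n × Fin τ) (v w : Fin m)
    (h : ptS m p v = ptS m q w) : p = q ∧ v = w := by
  obtain ⟨a, b⟩ := p
  obtain ⟨a', b'⟩ := q
  simp only [ptS, Prod.mk.injEq] at h
  obtain ⟨h1, h2⟩ := h
  have hv := v.2
  have hw := w.2
  have hm : 0 < m := by omega
  have h3 : b.1 * m + v.1 = b'.1 * m + w.1 := by omega
  have hb : b.1 = b'.1 := by
    have e1 : (b.1 * m + v.1) / m = b.1 := by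
      rw [mul_comm, Nat.mul_add_div hm, Nat.div_eq_of_lt hv, add_zero]
    have e2 : (b'.1 * m + w.1) / m = b'.1 := by
      rw [mul_comm, Nat.mul_add_div hm, Nat.div_eq_of_lt hw, add_zero]
    rw [← e1, ← e2, h3]
  rw [hb] at h3
  refine ⟨Prod.ext (Fin.ext (by simpa using h1)) (Fin.ext hb), Fin.ext (by omega)⟩

def cntS {n τ m : ℕ} (f : Fin n × Fin τ → Fin m) (X Y : Finset ℕ) : ℕ :=
  (univ.filter (fun p => ptS m p (f p) ∈ X ×ˢ Y)).card

lemma sum_cnt (n τ m k : ℕ) (hm : 0 < m) (X Y : Finset ℕ) (hX : X.card = k) (hY : Y.card = k) :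
    ∑ f : Fin n × Fin τ → Fin m, (2 : ℝ) ^ cntS f X Y
      ≤ (Fintype.card (Fin n × Fin τ → Fin m) : ℝ) * Real.exp ((k : ℝ) ^ 2 / m) := by
  have hm' : (0 : ℝ) < m := by exact_mod_cast hm
  have h1 : ∀ f : Fin n × Fin τ → Fin m, (2 : ℝ) ^ cntS f X Y
      = ∏ p, (if ptS m p (f p) ∈ X ×ˢ Y then (2 : ℝ) else 1) := by
    intro f
    rw [← Finset.prod_filter, Finset.prod_const, cntS]
  let c : Fin n × Fin τ → ℕ := fun p => (univ.filter (fun v : Fin m => ptS m p v ∈ X ×ˢ Y)).card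
  have h2 : ∑ f : Fin n × Fin τ → Fin m, (2 : ℝ) ^ cntS f X Y
      = ∏ p : Fin n × Fin τ, ((m : ℝ) + c p) := by
    simp_rw [h1]
    rw [← Fintype.piFinset_univ, ← Finset.prod_univ_sum (fun _ => univ)
      (fun p v => if ptS m p v ∈ X ×ˢ Y then (2 : ℝ) else 1)]
    refine Finset.prod_congr rfl fun p _ => ?_
    have : ∀ v : Fin m, (if ptS m p v ∈ X ×ˢ Y then (2 : ℝ) else 1)
        = 1 + (if ptS m p v ∈ X ×ˢ Y then (1 : ℝ) else 0) := by
      intro v; split_ifs <;> norm_num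
    simp_rw [this]
    rw [Finset.sum_add_distrib, Finset.sum_boole]
    simp [c]
  have h3 : ∑ p, c p ≤ k ^ 2 := by
    have : ∑ p, c p = ((univ : Finset (Fin n × Fin τ)).sigma
        (fun p => univ.filter (fun v : Fin m => ptS m p v ∈ X ×ˢ Y))).card := by
      rw [Finset.card_sigma]
    rw [this]
    have hc : (X ×ˢ Y).card = k ^ 2 := by rw [Finset.card_product, hX, hY, sq]
    rw [← hc]
    refine Finset.card_le_card_of_injOn (fun q => ptS m q.1 q.2) ?_ ?_
    · intro q hq
      have := (Finset.mem_sigma.1 (Finset.mem_coe.1 hq)).2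
      exact Finset.mem_coe.2 (Finset.mem_filter.1 this).2
    · rintro ⟨p, v⟩ _ ⟨q, w⟩ _ h
      obtain ⟨rfl, rfl⟩ := ptS_inj m p q v w h
      rfl
  have h4 : ∀ p, (m : ℝ) + c p ≤ m * Real.exp (c p / m) := by
    intro p
    have := Real.add_one_le_exp ((c p : ℝ) / m)
    calc (m : ℝ) + c p = m * (c p / m + 1) := by field_simp; ring
      _ ≤ _ := by gcongr
  rw [h2]
  calc ∏ p : Fin n × Fin τ, ((m : ℝ) + c p) ≤ ∏ p : Fin n × Fin τ, (m * Real.exp (c p / m)) :=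
        Finset.prod_le_prod (fun p _ => by positivity) (fun p _ => h4 p)
    _ = (Fintype.card (Fin n × Fin τ → Fin m) : ℝ) * Real.exp (∑ p, (c p : ℝ) / m) := by
        rw [Finset.prod_mul_distrib, Real.exp_sum]
        simp
    _ ≤ _ := by
        gcongr
        rw [← Finset.sum_div]
        gcongr
        exact_mod_cast h3

lemma exists_f (n τ m k : ℕ) (hm : 0 < m) :
    ∃ f : Fin n × Fin τ → Fin m, ∀ X Y : Finset ℕ, X ⊆ Icc 1 n → Y ⊆ Icc 1 n →
      X.card = k → Y.card = k →
      (2 : ℝ) ^ cntS f X Y ≤ (n : ℝ) ^ (2 * k) * Real.exp ((k : ℝ) ^ 2 / m) := by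
  haveI : Nonempty (Fin m) := ⟨⟨0, hm⟩⟩
  let P := powersetCard k (Icc 1 n) ×ˢ powersetCard k (Icc 1 n)
  have hP : (P.card : ℝ) ≤ (n : ℝ) ^ (2 * k) := by
    have : P.card ≤ n ^ (2 * k) := by
      simp only [P, Finset.card_product, Finset.card_powersetCard, Nat.card_Icc, Nat.add_sub_cancel]
      rw [two_mul, pow_add]
      exact Nat.mul_le_mul (Nat.choose_le_pow n k) (Nat.choose_le_pow n k)
    exact_mod_cast this
  have hs : ∑ f : Fin n × Fin τ → Fin m, ∑ q ∈ P, (2 : ℝ) ^ cntS f q.1 q.2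
      ≤ ∑ f : Fin n × Fin τ → Fin m, (n : ℝ) ^ (2 * k) * Real.exp ((k : ℝ) ^ 2 / m) := by
    rw [Finset.sum_comm]
    calc _ ≤ ∑ q ∈ P, (Fintype.card (Fin n × Fin τ → Fin m) : ℝ) * Real.exp ((k : ℝ) ^ 2 / m) := by
          refine Finset.sum_le_sum fun q hq => ?_
          have := Finset.mem_product.1 hq
          exact sum_cnt n τ m k hm _ _ (mem_powersetCard.1 this.1).2 (mem_powersetCard.1 this.2).2
      _ = (P.card : ℝ) * ((Fintype.card (Fin n × Fin τ → Fin m) : ℝ) *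
            Real.exp ((k : ℝ) ^ 2 / m)) := by rw [Finset.sum_const, nsmul_eq_mul]
      _ ≤ (n : ℝ) ^ (2 * k) * ((Fintype.card (Fin n × Fin τ → Fin m) : ℝ) *
            Real.exp ((k : ℝ) ^ 2 / m)) := by gcongr
      _ = _ := by rw [Finset.sum_const, nsmul_eq_mul, Finset.card_univ]; ring
  obtain ⟨f, -, hf⟩ := Finset.exists_le_of_sum_le Finset.univ_nonempty hs
  refine ⟨f, fun X Y hX hY hXc hYc => le_trans ?_ hf⟩
  exact Finset.single_le_sum (f := fun q : Finset ℕ × Finset ℕ => (2 : ℝ) ^ cntS f q.1 q.2)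
    (fun q _ => by positivity) (a := (X, Y))
    (Finset.mem_product.2 ⟨mem_powersetCard.2 ⟨hX, hXc⟩, mem_powersetCard.2 ⟨hY, hYc⟩⟩)

/-- The hard-instance construction for the line-3 join: a middle relation `S` between
`N/τ` groups of `B`-values and `N/τ` groups of `C`-values, of size `Θ(N)`, such that
every choice of `L/τ` groups on each side spans few pairs of `S`. -/
theorem stmt8 :
    ∃ (c : ℝ) (N₀ : ℕ), 0 < c ∧
      ∀ N τ L : ℕ, N₀ ≤ N → 1 ≤ τ → τ ^ 2 ≤ N → τ ∣ N → τ ∣ L → τ ≤ L → L ≤ N →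
        ∃ S : Finset (ℕ × ℕ),
          S ⊆ Finset.Icc 1 (N / τ) ×ˢ Finset.Icc 1 (N / τ) ∧
          (N : ℝ) / 2 ≤ (S.card : ℝ) ∧ (S.card : ℝ) ≤ 2 * (N : ℝ) ∧
          ∀ X Y : Finset ℕ, X ⊆ Finset.Icc 1 (N / τ) → Y ⊆ Finset.Icc 1 (N / τ) →
            X.card = L / τ → Y.card = L / τ →
            ((S ∩ X ×ˢ Y).card : ℝ) ≤
              c * max (((L / τ : ℕ) : ℝ) * Real.log N) ((L : ℝ) ^ 2 / (N : ℝ)) := by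
  refine ⟨8, 1, by norm_num, ?_⟩
  rintro N τ L hN hτ hτN ⟨n, rfl⟩ ⟨k, rfl⟩ - -
  have hτ0 : 0 < τ := hτ
  rw [Nat.mul_div_cancel_left _ hτ0, Nat.mul_div_cancel_left _ hτ0]
  have hτn : τ ≤ n := by
    rw [sq] at hτN
    exact Nat.le_of_mul_le_mul_left hτN hτ0
  have hn : 0 < n := by omega
  obtain ⟨m, hmdef⟩ : ∃ m, m = n / τ := ⟨_, rfl⟩
  have hm : 0 < m := by rw [hmdef]; exact Nat.div_pos hτn hτ0
  have hmn : τ * m ≤ n := by rw [hmdef]; exact Nat.mul_div_le n τ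
  have hnm : n ≤ 2 * (τ * m) := by
    have := Nat.lt_mul_div_succ n hτ0
    rw [← hmdef, Nat.mul_add] at this
    have : τ * 1 ≤ τ * m := Nat.mul_le_mul_left _ hm
    omega
  obtain ⟨f, hf⟩ := exists_f n τ m k hm
  have hcard : (univ.image (fun p => ptS m p (f p))).card = τ * n := by
    rw [Finset.card_image_of_injective _ (fun p q h => (ptS_inj m p q _ _ h).1)]
    simp [mul_comm]
  refine ⟨univ.image (fun p => ptS m p (f p)), ?_, ?_, ?_, ?_⟩
  · intro x hx
    obtain ⟨p, -, rfl⟩ := Finset.mem_image.1 hx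
    have h1 := p.1.2
    have h2 := (f p).2
    have h3 : (p.2.1 + 1) * m ≤ τ * m := Nat.mul_le_mul_right _ p.2.2
    rw [Nat.add_mul] at h3
    simp only [ptS, Finset.mem_product, Finset.mem_Icc]
    omega
  · rw [hcard]
    have : (0 : ℝ) ≤ ((τ * n : ℕ) : ℝ) := by positivity
    linarith
  · rw [hcard]
    have : (0 : ℝ) ≤ ((τ * n : ℕ) : ℝ) := by positivity
    linarith
  · intro X Y hX hY hXc hYc
    have hb := hf X Y hX hY hXc hYc
    have hle : (univ.image (fun p => ptS m p (f p)) ∩ X ×ˢ Y).card ≤ cntS f X Y := by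
      refine le_trans (Finset.card_le_card ?_) (Finset.card_image_le (f := fun p => ptS m p (f p)))
      intro x hx
      obtain ⟨hx1, hx2⟩ := Finset.mem_inter.1 hx
      obtain ⟨p, -, rfl⟩ := Finset.mem_image.1 hx1
      exact Finset.mem_image.2 ⟨p, Finset.mem_filter.2 ⟨Finset.mem_univ _, hx2⟩, rfl⟩
    have hle' : ((univ.image (fun p => ptS m p (f p)) ∩ X ×ˢ Y).card : ℝ) ≤ cntS f X Y := by
      exact_mod_cast hle
    refine hle'.trans ?_
    have hn' : (0 : ℝ) < n := by exact_mod_cast hn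
    have hm' : (0 : ℝ) < m := by exact_mod_cast hm
    have hτ' : (0 : ℝ) < τ := by exact_mod_cast hτ0
    have hlog := Real.log_le_log (by positivity) hb
    rw [Real.log_mul (by positivity) (by positivity), Real.log_exp, Real.log_pow, Real.log_pow] at hlog
    push_cast at hlog ⊢
    have hA : (k : ℝ) * Real.log n ≤ k * Real.log (τ * n) := by
      gcongr
      have : (1 : ℝ) ≤ τ := by exact_mod_cast hτ
      nlinarith
    have hB : (k : ℝ) ^ 2 / m ≤ 2 * ((τ * k : ℝ) ^ 2 / (τ * n)) := by
      have hnm' : (n : ℝ) ≤ 2 * (τ * m) := by exact_mod_cast hnm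
      have : 2 * ((τ * k : ℝ) ^ 2 / (τ * n)) = (2 * τ * k ^ 2) / n := by field_simp
      rw [this, div_le_div_iff₀ hm' hn']
      nlinarith [sq_nonneg (k : ℝ)]
    have h1 := le_max_left ((k : ℝ) * Real.log (τ * n)) ((τ * k : ℝ) ^ 2 / (τ * n))
    have h2 := le_max_right ((k : ℝ) * Real.log (τ * n)) ((τ * k : ℝ) ^ 2 / (τ * n))
    have hl2 : (1 : ℝ) / 2 ≤ Real.log 2 := by linarith [Real.log_two_gt_d9]
    have hc0 : (0 : ℝ) ≤ cntS f X Y := by positivity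
    nlinarith
end

section
/- There is an absolute constant C such that for every integer n ≥ 2 and every real q ∈ (0,1] with q·n² ≥ C·log n, there exists a set S ⊆ {1,…,n} × {1,…,n} with q·n²/2 ≤ |S| ≤ 2·q·n², such that for all subsets X, Y ⊆ {1,…,n}, one has |S ∩ (X × Y)| ≤ C·( q·|X|·|Y| + (|X| + |Y| + 1)·log n ). -/
open Finset

lemma mgf_aux (U R : Finset (ℕ × ℕ)) (hR : R ⊆ U) (q l : ℝ) (h0 : 0 < q) (h1 : q ≤ 1) :
    ∑ S ∈ U.powerset, (q ^ S.card * (1 - q) ^ (U.card - S.card)) * Real.exp (l * ((S ∩ R).card : ℝ))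
      ≤ Real.exp ((Real.exp l - 1) * (q * R.card)) := by
  have key := Finset.prod_add (fun i => q * (if i ∈ R then Real.exp l else 1))
    (fun _ : ℕ × ℕ => 1 - q) U
  have e1 : ∑ S ∈ U.powerset, (q ^ S.card * (1 - q) ^ (U.card - S.card)) *
      Real.exp (l * ((S ∩ R).card : ℝ)) =
      ∏ i ∈ U, (q * (if i ∈ R then Real.exp l else 1) + (1 - q)) := by
    rw [key]
    apply Finset.sum_congr rfl
    intro S hS
    have hS := Finset.mem_powerset.1 hS
    rw [Finset.prod_mul_distrib, Finset.prod_const, Finset.prod_const,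
      Finset.card_sdiff_of_subset hS, Finset.prod_ite_mem, Finset.prod_const,
      mul_comm l, Real.exp_nat_mul]
    ring
  rw [e1]
  calc ∏ i ∈ U, (q * (if i ∈ R then Real.exp l else 1) + (1 - q))
      ≤ ∏ i ∈ U, (if i ∈ R then Real.exp ((Real.exp l - 1) * q) else 1) := by
        apply Finset.prod_le_prod
        · intro i _
          have := Real.exp_pos l
          split_ifs <;> nlinarith [mul_pos h0 this]
        · intro i _
          split_ifs
          · have := Real.add_one_le_exp ((Real.exp l - 1) * q)
            linarith
          · linarith
    _ = Real.exp ((Real.exp l - 1) * (q * R.card)) := by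
        rw [Finset.prod_ite_mem, Finset.inter_eq_right.2 hR, Finset.prod_const,
          ← Real.exp_nat_mul]
        congr 1; ring

/-- A random bipartite graph of edge density `q` in which no rectangle is substantially
denser than expected: the probabilistic core of the output-sensitive lower bounds. -/
theorem stmt9 :
    ∃ C : ℝ, ∀ (n : ℕ) (q : ℝ), 2 ≤ n → 0 < q → q ≤ 1 →
      C * Real.log n ≤ q * (n : ℝ) ^ 2 →
      ∃ S : Finset (ℕ × ℕ),
        S ⊆ Finset.Icc 1 n ×ˢ Finset.Icc 1 n ∧
        q * (n : ℝ) ^ 2 / 2 ≤ (S.card : ℝ) ∧ (S.card : ℝ) ≤ 2 * q * (n : ℝ) ^ 2 ∧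
        ∀ X Y : Finset ℕ, X ⊆ Finset.Icc 1 n → Y ⊆ Finset.Icc 1 n →
          ((S ∩ X ×ˢ Y).card : ℝ) ≤
            C * (q * (X.card : ℝ) * (Y.card : ℝ) +
              ((X.card : ℝ) + (Y.card : ℝ) + 1) * Real.log n) := by
  refine ⟨100, fun n q hn h0 h1 hC => ?_⟩
  set I := Finset.Icc 1 n with hI
  have hIc : I.card = n := by simp [hI]
  set U := I ×ˢ I with hU
  have hUc : (U.card : ℝ) = (n : ℝ) ^ 2 := by
    rw [hU, Finset.card_product, hIc]; push_cast; ring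
  have hn' : (2 : ℝ) ≤ n := by exact_mod_cast hn
  set L := Real.log n with hL
  have hL2 : 0.69 < L := by
    have h : Real.log 2 ≤ L := Real.log_le_log (by norm_num) hn'
    linarith [Real.log_two_gt_d9]
  have hM : 69 ≤ q * (n : ℝ) ^ 2 := by linarith
  set M := q * (n : ℝ) ^ 2 with hMd
  set w : Finset (ℕ × ℕ) → ℝ := fun S => q ^ S.card * (1 - q) ^ (U.card - S.card) with hw
  have hw0 : ∀ S, 0 ≤ w S := fun S =>
    mul_nonneg (pow_nonneg h0.le _) (pow_nonneg (by linarith) _)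
  have hw1 : ∑ S ∈ U.powerset, w S = 1 := by
    rw [hw, Finset.sum_pow_mul_eq_add_pow]; simp
  have he := Real.exp_one_gt_d9
  have he' := Real.exp_one_lt_d9
  have hem : Real.exp (-1) < 0.37 := by
    rw [Real.exp_neg]
    rw [inv_lt_comm₀ (Real.exp_pos _) (by norm_num)]
    norm_num; linarith
  have hem2 : Real.exp (-2) < 0.14 := by
    have : Real.exp (-2) = Real.exp (-1) * Real.exp (-1) := by rw [← Real.exp_add]; norm_num
    rw [this]; nlinarith [Real.exp_pos (-1)]
  -- the potential function
  set A : Finset (ℕ × ℕ) → ℝ := fun S => Real.exp (S.card - 2 * M) with hA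
  set B : Finset (ℕ × ℕ) → ℝ := fun S => Real.exp (M / 2 - S.card) with hB
  set T : Finset (ℕ × ℕ) → Finset ℕ × Finset ℕ → ℝ := fun S p =>
    Real.exp ((S ∩ p.1 ×ˢ p.2).card - 2 * (q * (p.1.card * p.2.card)) -
      3 * (p.1.card + p.2.card + 1) * L) with hT
  have EA : ∑ S ∈ U.powerset, w S * A S < 0.14 := by
    have := mgf_aux U U subset_rfl q 1 h0 h1
    have e : ∑ S ∈ U.powerset, w S * A S = Real.exp (-2 * M) *
        ∑ S ∈ U.powerset, w S * Real.exp (1 * ((S ∩ U).card : ℝ)) := by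
      rw [Finset.mul_sum]
      refine Finset.sum_congr rfl fun S hS => ?_
      rw [Finset.inter_eq_left.2 (Finset.mem_powerset.1 hS), mul_left_comm (Real.exp _), ← Real.exp_add]
      refine congrArg (w S * ·) (congrArg Real.exp ?_)
      ring
    rw [e]
    refine lt_of_le_of_lt (mul_le_mul_of_nonneg_left this (Real.exp_pos _).le) ?_
    rw [← Real.exp_add, hUc, ← hMd]
    refine lt_of_le_of_lt (Real.exp_le_exp.2 ?_) hem2
    nlinarith
  have EB : ∑ S ∈ U.powerset, w S * B S < 0.14 := by
    have := mgf_aux U U subset_rfl q (-1) h0 h1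
    have e : ∑ S ∈ U.powerset, w S * B S = Real.exp (M / 2) *
        ∑ S ∈ U.powerset, w S * Real.exp (-1 * ((S ∩ U).card : ℝ)) := by
      rw [Finset.mul_sum]
      refine Finset.sum_congr rfl fun S hS => ?_
      rw [Finset.inter_eq_left.2 (Finset.mem_powerset.1 hS), mul_left_comm (Real.exp _), ← Real.exp_add]
      refine congrArg (w S * ·) (congrArg Real.exp ?_)
      ring
    rw [e]
    refine lt_of_le_of_lt (mul_le_mul_of_nonneg_left this (Real.exp_pos _).le) ?_
    rw [← Real.exp_add, hUc, ← hMd]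
    refine lt_of_le_of_lt (Real.exp_le_exp.2 ?_) hem2
    nlinarith
  set a := Real.exp (-3 * L) with ha
  have ha0 : 0 < a := Real.exp_pos _
  have han : a * (n : ℝ) ^ 3 = 1 := by
    have hn0 : (n : ℝ) = Real.exp L := (Real.exp_log (by linarith)).symm
    rw [hn0, ha, ← Real.exp_nat_mul, ← Real.exp_add]
    simp
  have ET : ∀ p ∈ I.powerset ×ˢ I.powerset, ∑ S ∈ U.powerset, w S * T S p ≤
      a * (a ^ p.1.card * a ^ p.2.card) := by
    intro p hp
    have hp := Finset.mem_product.1 hp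
    have hR : p.1 ×ˢ p.2 ⊆ U := Finset.product_subset_product
      (Finset.mem_powerset.1 hp.1) (Finset.mem_powerset.1 hp.2)
    have := mgf_aux U _ hR q 1 h0 h1
    have e : ∑ S ∈ U.powerset, w S * T S p =
        Real.exp (- 2 * (q * (p.1.card * p.2.card)) - 3 * (p.1.card + p.2.card + 1) * L) *
        ∑ S ∈ U.powerset, w S * Real.exp (1 * ((S ∩ p.1 ×ˢ p.2).card : ℝ)) := by
      rw [Finset.mul_sum]
      refine Finset.sum_congr rfl fun S hS => ?_
      rw [mul_left_comm (Real.exp _), ← Real.exp_add]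
      refine congrArg (w S * ·) (congrArg Real.exp ?_)
      ring
    rw [e]
    refine (mul_le_mul_of_nonneg_left this (Real.exp_pos _).le).trans ?_
    rw [← Real.exp_add, ha, ← Real.exp_nat_mul, ← Real.exp_nat_mul, ← Real.exp_add,
      ← Real.exp_add, Finset.card_product]
    apply Real.exp_le_exp.2
    push_cast
    have : 0 ≤ q * ((p.1.card : ℝ) * p.2.card) := by positivity
    nlinarith
  have ETs : ∑ S ∈ U.powerset, w S * ∑ p ∈ I.powerset ×ˢ I.powerset, T S p < 0.5 := by
    simp_rw [Finset.mul_sum]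
    rw [Finset.sum_comm]
    refine lt_of_le_of_lt (Finset.sum_le_sum ET) ?_
    rw [← Finset.mul_sum, Finset.sum_product]
    simp_rw [← Finset.mul_sum]
    rw [← Finset.sum_mul]
    have hs : ∑ X ∈ I.powerset, a ^ X.card = (a + 1) ^ n := by
      have := Finset.sum_pow_mul_eq_add_pow a 1 I
      simpa [hIc] using this
    rw [hs]
    have hna : n * a ≤ 1 / 4 := by
      have : 0 < n * a := by positivity
      nlinarith
    have ha8 : a ≤ 1 / 8 := by nlinarith
    have hp : (a + 1) ^ n ≤ Real.exp (1 / 4) := by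
      calc (a + 1) ^ n ≤ (Real.exp a) ^ n :=
            pow_le_pow_left₀ (by linarith) (Real.add_one_le_exp a) n
        _ = Real.exp (n * a) := (Real.exp_nat_mul _ _).symm
        _ ≤ _ := Real.exp_le_exp.2 hna
    have hpp : (a + 1) ^ n * (a + 1) ^ n ≤ Real.exp 1 := by
      calc _ ≤ Real.exp (1 / 4) * Real.exp (1 / 4) :=
            mul_le_mul hp hp (by positivity) (by positivity)
        _ ≤ _ := by rw [← Real.exp_add]; exact Real.exp_le_exp.2 (by norm_num)
    nlinarith
  have hex : ∃ S ∈ U.powerset, A S + B S + ∑ p ∈ I.powerset ×ˢ I.powerset, T S p < 1 := by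
    by_contra! hcon
    have : ∑ S ∈ U.powerset, w S ≤ ∑ S ∈ U.powerset,
        w S * (A S + B S + ∑ p ∈ I.powerset ×ˢ I.powerset, T S p) :=
      Finset.sum_le_sum fun S hS => le_mul_of_one_le_right (hw0 S) (hcon S hS)
    simp_rw [mul_add] at this
    rw [Finset.sum_add_distrib, Finset.sum_add_distrib] at this
    linarith
  obtain ⟨S, hS, hlt⟩ := hex
  have pA : 0 < A S := Real.exp_pos _
  have pB : 0 < B S := Real.exp_pos _
  have pT : ∀ p ∈ I.powerset ×ˢ I.powerset, 0 ≤ T S p := fun p _ => (Real.exp_pos _).le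
  have pTs := Finset.sum_nonneg pT
  refine ⟨S, Finset.mem_powerset.1 hS, ?_, ?_, ?_⟩
  · have : B S < 1 := by linarith
    have := Real.exp_lt_one_iff.1 this
    linarith
  · have : A S < 1 := by linarith
    have := Real.exp_lt_one_iff.1 this
    linarith
  · intro X Y hX hY
    have h := Finset.single_le_sum pT (Finset.mk_mem_product
      (Finset.mem_powerset.2 hX) (Finset.mem_powerset.2 hY))
    have : T S (X, Y) < 1 := by linarith
    have h1' : ((S ∩ X ×ˢ Y).card : ℝ) - 2 * (q * (X.card * Y.card)) -
      3 * (X.card + Y.card + 1) * L < 0 := Real.exp_lt_one_iff.1 this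
    clear this h
    have h2 : 0 ≤ q * ((X.card : ℝ) * Y.card) := by positivity
    have h3 : 0 ≤ ((X.card : ℝ) + Y.card + 1) * L := by
      have : 0 < L := by linarith
      positivity
    rw [mul_assoc q]
    rw [mul_assoc 3] at h1'
    linarith
end

section
/- Let IN, OUT, p be reals with 1 ≤ p ≤ IN, IN > 1, and OUT > IN, and let k* = ⌈log OUT / log IN⌉ (so k* ≥ 2). Then IN · p^{−1/max(1, k*−1)} + (OUT/p)^{1/k*} ≤ 2·( IN/p + (OUT/p)^{1/2} ). -/
/-- The output-optimal load bound for r-hierarchical joins implies the cleaner bound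
`O(IN/p + √(OUT/p))`: with `k* = ⌈log_IN OUT⌉`,
`IN·p^(−1/max(1,k*−1)) + (OUT/p)^(1/k*) ≤ 2·(IN/p + (OUT/p)^(1/2))`. -/
theorem stmt12 (IN OUT p : ℝ) (hp : 1 ≤ p) (hpIN : p ≤ IN) (hIN : 1 < IN)
    (hOUT : IN < OUT) (kstar : ℤ) (hk : kstar = ⌈Real.log OUT / Real.log IN⌉) :
    IN * p ^ (-(1 / ((max 1 (kstar - 1) : ℤ) : ℝ))) + (OUT / p) ^ (1 / (kstar : ℝ)) ≤
      2 * (IN / p + (OUT / p) ^ ((1 : ℝ) / 2)) := by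
  have hp0 : 0 < p := by linarith
  have hI0 : 0 < IN := by linarith
  have hO0 : 0 < OUT := by linarith
  have hl : 0 < Real.log IN := Real.log_pos hIN
  have hk2 : 2 ≤ kstar := by
    have : (1 : ℤ) < kstar := by
      rw [hk, Int.lt_ceil, lt_div_iff₀ hl]
      simpa using Real.log_lt_log hI0 hOUT
    omega
  have hpow : ∀ n : ℕ, (n : ℤ) < kstar → IN ^ n < OUT := by
    intro n hn
    rw [hk, Int.lt_ceil, lt_div_iff₀ hl] at hn
    have hn' : (n : ℝ) * Real.log IN < Real.log OUT := by exact_mod_cast hn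
    rw [← Real.log_pow] at hn'
    exact (Real.log_lt_log_iff (by positivity) hO0).1 hn'
  have hOp : 1 ≤ OUT / p := by rw [le_div_iff₀ hp0]; linarith
  have hkR : (2 : ℝ) ≤ (kstar : ℝ) := by exact_mod_cast hk2
  have h1 : (OUT / p) ^ (1 / (kstar : ℝ)) ≤ (OUT / p) ^ ((1 : ℝ) / 2) :=
    Real.rpow_le_rpow_of_exponent_le hOp (one_div_le_one_div_of_le (by norm_num) hkR)
  have hs0 : 0 ≤ (OUT / p) ^ ((1 : ℝ) / 2) := by positivity
  have hd0 : 0 ≤ IN / p := by positivity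
  have h2 : IN * p ^ (-(1 / ((max 1 (kstar - 1) : ℤ) : ℝ))) ≤
      IN / p + (OUT / p) ^ ((1 : ℝ) / 2) := by
    rcases (by omega : kstar = 2 ∨ kstar = 3 ∨ 4 ≤ kstar) with h | h | h
    · have e : (max 1 (kstar - 1) : ℤ) = 1 := by omega
      rw [e]
      have : IN * p ^ (-(1 / ((1 : ℤ) : ℝ))) = IN / p := by
        norm_num [Real.rpow_neg_one, div_eq_mul_inv]
      linarith
    · have e : (max 1 (kstar - 1) : ℤ) = 2 := by omega
      rw [e]
      have h3 := hpow 2 (by omega)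
      have : IN * p ^ (-(1 / ((2 : ℤ) : ℝ))) ≤ (OUT / p) ^ ((1 : ℝ) / 2) := by
        rw [← Real.sqrt_eq_rpow, Real.rpow_neg hp0.le]
        push_cast
        rw [← Real.sqrt_eq_rpow, Real.sqrt_div hO0.le, ← div_eq_mul_inv]
        gcongr
        exact Real.le_sqrt_of_sq_le h3.le
      linarith
    · have h3 := hpow 3 (by omega)
      have h4 : p ^ (-(1 / ((max 1 (kstar - 1) : ℤ) : ℝ))) ≤ 1 := by
        apply Real.rpow_le_one_of_one_le_of_nonpos hp
        have : (0 : ℝ) ≤ ((max 1 (kstar - 1) : ℤ) : ℝ) := by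
          exact_mod_cast (by omega : (0 : ℤ) ≤ max 1 (kstar - 1))
        have := one_div_nonneg.2 this
        linarith
      have h5 : IN ≤ (OUT / p) ^ ((1 : ℝ) / 2) := by
        rw [← Real.sqrt_eq_rpow]
        apply Real.le_sqrt_of_sq_le
        rw [le_div_iff₀ hp0]
        nlinarith [mul_le_mul_of_nonneg_left hpIN (sq_nonneg IN)]
      have h6 := mul_le_mul_of_nonneg_left h4 hI0.le
      linarith
  linarith
end

section
/- Let IN, OUT, p be reals with p ≥ 1, IN > 1, OUT ≥ IN, and OUT ≥ p, and let k* = ⌈log OUT / log IN⌉ (so k* ≥ 1). Then for every integer k ≥ 1, min{ IN · p^{−1/k} , (OUT/p)^{1/k} } ≤ max{ IN · p^{−1/max(1, k*−1)} , (OUT/p)^{1/k*} }. -/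
/-- The max–min computation behind the closed-form output-optimal bound: with
`k* = ⌈log_IN OUT⌉`, for every integer `k ≥ 1`,
`min{IN·p^(−1/k), (OUT/p)^(1/k)} ≤ max{IN·p^(−1/max(1,k*−1)), (OUT/p)^(1/k*)}`. -/
theorem stmt13 (IN OUT p : ℝ) (hp : 1 ≤ p) (hIN : 1 < IN) (hINOUT : IN ≤ OUT)
    (hpOUT : p ≤ OUT) (kstar : ℤ) (hk : kstar = ⌈Real.log OUT / Real.log IN⌉) :
    ∀ k : ℤ, 1 ≤ k →
      min (IN * p ^ (-(1 / (k : ℝ)))) ((OUT / p) ^ (1 / (k : ℝ))) ≤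
        max (IN * p ^ (-(1 / ((max 1 (kstar - 1) : ℤ) : ℝ))))
          ((OUT / p) ^ (1 / (kstar : ℝ))) := by
  intro k hk1
  have hl : 0 < Real.log IN := Real.log_pos hIN
  have hlo : 0 < Real.log OUT := Real.log_pos (lt_of_lt_of_le hIN hINOUT)
  have hks : 1 ≤ kstar := by
    have : 0 < kstar := by
      rw [hk]; exact Int.ceil_pos.mpr (div_pos hlo hl)
    omega
  have hp0 : 0 < p := by linarith
  by_cases h : kstar ≤ k
  · apply le_trans (min_le_right _ _)
    apply le_trans _ (le_max_right _ _)
    have h1 : 1 ≤ OUT / p := (one_le_div hp0).mpr hpOUT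
    apply Real.rpow_le_rpow_of_exponent_le h1
    have h2 : (0 : ℝ) < kstar := by exact_mod_cast (by omega : 0 < kstar)
    exact one_div_le_one_div_of_le h2 (by exact_mod_cast h)
  · apply le_trans (min_le_left _ _)
    apply le_trans _ (le_max_left _ _)
    apply mul_le_mul_of_nonneg_left _ (by linarith)
    apply Real.rpow_le_rpow_of_exponent_le hp
    have h2 : (0 : ℝ) < k := by exact_mod_cast (by omega : 0 < k)
    have h3 : k ≤ max 1 (kstar - 1) := le_max_of_le_right (by omega)
    exact neg_le_neg (one_div_le_one_div_of_le h2 (Int.cast_le.mpr h3))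
end

section
/- A join-aggregate query Q_y = ((V,E), y) is out-hierarchical if and only if it has a width-1 GHD T with a connex subset T' such that y = ∪_{u∈T'} u and the hypergraph (y, {u : u ∈ T'}) is r-hierarchical. -/
open Finset

/-- A width-1 GHD of a hypergraph `(V, E)`: a tree `T` on a node type `ι` with bags
`bag : ι → Finset V` such that (1) for each attribute `x`, the nodes containing `x`
induce a connected subtree; (2) each hyperedge is contained in some bag; (3) each bag
is contained in some hyperedge. -/
def IsWidth1GHD {V : Type} (E : Finset (Finset V)) {ι : Type} [Fintype ι]
    (T : SimpleGraph ι) (bag : ι → Finset V) : Prop :=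
  T.IsTree ∧ (∀ x : V, (T.induce {i | x ∈ bag i}).Preconnected) ∧
    (∀ e ∈ E, ∃ i, e ⊆ bag i) ∧ (∀ i, ∃ e ∈ E, bag i ⊆ e)

/-- A connex subset of a rooted tree: a set of nodes containing the root that induces a
connected subtree. -/
def IsConnex {ι : Type} (T : SimpleGraph ι) (r : ι) (T' : Finset ι) : Prop :=
  r ∈ T' ∧ (T.induce (T' : Set ι)).Preconnected

/-- A join-aggregate query `Q_y` is free-connex if it has a width-1 GHD `T` with a
connex subset `T'` such that `y = ⋃_{u ∈ T'} u`. -/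
def FreeConnex {V : Type} [DecidableEq V] (E : Finset (Finset V)) (y : Finset V) :
    Prop :=
  ∃ (ι : Type) (_ : Fintype ι) (T : SimpleGraph ι) (bag : ι → Finset V) (r : ι)
    (T' : Finset ι),
    IsWidth1GHD E T bag ∧ IsConnex T r T' ∧ y = T'.biUnion bag

/-- A join-aggregate query `Q_y` is out-hierarchical if it is free-connex and the
residual hypergraph `(y, {e ∩ y : e ∈ E})` is r-hierarchical. -/
def OutHierarchical {V : Type} [DecidableEq V] (E : Finset (Finset V))
    (y : Finset V) : Prop :=
  FreeConnex E y ∧ RHierarchical (E.image (fun e => e ∩ y))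

theorem aux_walk {ι : Type} {T : SimpleGraph ι} {S : Set ι} (h : (T.induce S).Preconnected)
    {a b : ι} (ha : a ∈ S) (hb : b ∈ S) : ∃ w : T.Walk a b, ∀ v ∈ w.support, v ∈ S := by
  obtain ⟨w⟩ := h ⟨a, ha⟩ ⟨b, hb⟩
  refine ⟨w.map (SimpleGraph.Embedding.induce S).toHom, ?_⟩
  intro v hv
  have hv2 := (congrArg (fun l => v ∈ l)
    (SimpleGraph.Walk.support_map (SimpleGraph.Embedding.induce S).toHom w)).mp hv
  obtain ⟨u, _, rfl⟩ := List.mem_map.1 hv2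
  exact u.2

theorem aux_gate_s14 {V : Type} [DecidableEq V] {ι : Type} {T : SimpleGraph ι} (hT : T.IsTree)
    (bag : ι → Finset V) (hx : ∀ x : V, (T.induce {i | x ∈ bag i}).Preconnected)
    (T' : Finset ι) (hc : (T.induce (T' : Set ι)).Preconnected) {i r : ι} (p : T.Walk i r) :
    p.IsPath → r ∈ T' → ∃ j ∈ T', bag i ∩ T'.biUnion bag ⊆ bag j := by
  classical
  induction p with
  | nil => exact fun _ hr => ⟨_, hr, Finset.inter_subset_left⟩
  | @cons i i' r h p' ih =>
    intro hp hr
    rw [SimpleGraph.Walk.cons_isPath_iff] at hp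
    by_cases hi : i ∈ T'
    · exact ⟨i, hi, Finset.inter_subset_left⟩
    obtain ⟨j, hj, hsub⟩ := ih hp.1 hr
    refine ⟨j, hj, fun x hxm => hsub ?_⟩
    rw [Finset.mem_inter] at hxm ⊢
    refine ⟨?_, hxm.2⟩
    obtain ⟨k, hk, hxk⟩ := Finset.mem_biUnion.1 hxm.2
    obtain ⟨q, hq⟩ := aux_walk hc (a := r) (b := k) hr hk
    obtain ⟨s, hs⟩ := aux_walk (hx x) (a := i) (b := k) hxm.1 hxk
    have h1 : i ∉ (p'.append q).bypass.support := by
      intro hm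
      have := SimpleGraph.Walk.support_bypass_subset_support _ hm
      rw [SimpleGraph.Walk.mem_support_append_iff] at this
      rcases this with h | h
      · exact hp.2 h
      · exact hi (hq _ h)
    have h2 : (SimpleGraph.Walk.cons h (p'.append q).bypass).IsPath :=
      (SimpleGraph.Walk.bypass_isPath _).cons h1
    have h3 : SimpleGraph.Walk.cons h (p'.append q).bypass = s.bypass :=
      (hT.existsUnique_path i k).unique h2 (SimpleGraph.Walk.bypass_isPath _)
    refine hs i' (SimpleGraph.Walk.support_bypass_subset_support _ ?_)
    rw [← h3]
    simp

theorem aux_reduce {V : Type} [DecidableEq V] {A B : Finset (Finset V)}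
    (h1 : ∀ a ∈ A, ∃ b ∈ B, a ⊆ b) (h2 : ∀ b ∈ B, ∃ a ∈ A, b ⊆ a) :
    reduceHG A ⊆ reduceHG B := by
  intro e he
  simp only [reduceHG, Finset.mem_filter] at he ⊢
  obtain ⟨he, hm⟩ := he
  have key : ∀ f ∈ B, e ⊆ f → e = f := by
    intro f hf hef
    obtain ⟨a, ha, hfa⟩ := h2 f hf
    have := hm a ha (hef.trans hfa)
    subst this
    exact hef.antisymm hfa
  obtain ⟨f, hf, hef⟩ := h1 e he
  refine ⟨?_, key⟩
  rw [key f hf hef]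
  exact hf

theorem aux_main {V : Type} [DecidableEq V] {E : Finset (Finset V)} {ι : Type} [Fintype ι]
    {T : SimpleGraph ι} {bag : ι → Finset V} {r : ι} {T' : Finset ι}
    (hG : IsWidth1GHD E T bag) (hc : IsConnex T r T') :
    reduceHG (E.image (fun e => e ∩ T'.biUnion bag)) = reduceHG (T'.image bag) := by
  obtain ⟨hT, hx, hE, hb⟩ := hG
  have h1 : ∀ a ∈ E.image (fun e => e ∩ T'.biUnion bag), ∃ b ∈ T'.image bag, a ⊆ b := by
    intro a ha
    obtain ⟨e, he, rfl⟩ := Finset.mem_image.1 ha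
    obtain ⟨i, hi⟩ := hE e he
    obtain ⟨p, hp, _⟩ := hT.existsUnique_path i r
    obtain ⟨j, hj, hs⟩ := aux_gate_s14 hT bag hx T' hc.2 p hp hc.1
    exact ⟨bag j, Finset.mem_image_of_mem _ hj,
      (Finset.inter_subset_inter_right hi).trans hs⟩
  have h2 : ∀ b ∈ T'.image bag, ∃ a ∈ E.image (fun e => e ∩ T'.biUnion bag), b ⊆ a := by
    intro b hbm
    obtain ⟨j, hj, rfl⟩ := Finset.mem_image.1 hbm
    obtain ⟨e, he, hs⟩ := hb j
    exact ⟨_, Finset.mem_image_of_mem _ he,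
      Finset.subset_inter hs (Finset.subset_biUnion_of_mem bag hj)⟩
  exact (aux_reduce h1 h2).antisymm (aux_reduce h2 h1)

/-- A join-aggregate query is out-hierarchical iff it has a width-1 GHD `T` with a
connex subset `T'` such that `y = ⋃_{u ∈ T'} u` and the hypergraph `(y, {u : u ∈ T'})`
is r-hierarchical. -/
theorem stmt14 {V : Type} [Fintype V] [DecidableEq V] (E : Finset (Finset V))
    (hcover : ∀ v : V, ∃ e ∈ E, v ∈ e) (y : Finset V) :
    OutHierarchical E y ↔
      ∃ (ι : Type) (_ : Fintype ι) (T : SimpleGraph ι) (bag : ι → Finset V) (r : ι)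
        (T' : Finset ι),
        IsWidth1GHD E T bag ∧ IsConnex T r T' ∧ y = T'.biUnion bag ∧
        RHierarchical (T'.image bag) := by
  constructor
  · rintro ⟨⟨ι, hι, T, bag, r, T', hG, hc, rfl⟩, hR⟩
    refine ⟨ι, hι, T, bag, r, T', hG, hc, rfl, ?_⟩
    unfold RHierarchical at hR ⊢
    rwa [aux_main hG hc] at hR
  · rintro ⟨ι, hι, T, bag, r, T', hG, hc, rfl, hR⟩
    refine ⟨⟨ι, hι, T, bag, r, T', hG, hc, rfl⟩, ?_⟩
    unfold RHierarchical at hR ⊢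
    rwa [aux_main hG hc]
end

section
/- Let Q = (V,E) be a join with ∪E = V, let T be a width-1 GHD of Q with root r, let T' be a connex subset of T, and let y = ∪_{u∈T'} u. Let u be a node of T with u ∉ T' (so u ≠ r), let u' be the parent of u in T, and let ȳ' = { x ∈ u : x ∉ y and no proper ancestor of u in T contains x }. Then u ∖ ȳ' ⊆ u'. -/
open Finset

theorem exists_walk_of_induce {ι : Type} (T : SimpleGraph ι) (S : Set ι)
    (h : (T.induce S).Preconnected) (a b : ι) (ha : a ∈ S) (hb : b ∈ S) :
    ∃ p : T.Walk a b, ∀ w ∈ p.support, w ∈ S := by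
  obtain ⟨p⟩ := h ⟨a, ha⟩ ⟨b, hb⟩
  refine ⟨p.map (SimpleGraph.Embedding.induce S).toHom, ?_⟩
  intro w hw
  have hw' : w ∈ p.support.map (fun z : S => (z : ι)) := by
    have e := SimpleGraph.Walk.support_map (SimpleGraph.Embedding.induce (G := T) S).toHom p
    exact (congrArg (fun l => w ∈ l) e).mp hw
  obtain ⟨z, -, rfl⟩ := List.mem_map.1 hw'
  exact z.2

/-- Let `T` be a width-1 GHD with root `r`, `T'` a connex subset, and
`y = ⋃_{u ∈ T'} u`.  Let `u ∉ T'` be a node, let `u'` be the parent of `u`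
(witnessed by the path `cons hadj q` from `u` to the root `r`), and let
`ȳ' = {x ∈ bag u | x ∉ y ∧ no proper ancestor of u contains x}`.
Then `bag u ∖ ȳ' ⊆ bag u'`. -/
theorem stmt15 {V ι : Type} [Fintype V] [DecidableEq V] [Fintype ι]
    (E : Finset (Finset V)) (hcover : ∀ v : V, ∃ e ∈ E, v ∈ e)
    (T : SimpleGraph ι) (bag : ι → Finset V) (hGHD : IsWidth1GHD E T bag)
    (r : ι) (T' : Finset ι) (hroot : r ∈ T')
    (hconnex : (T.induce (T' : Set ι)).Preconnected)
    (y : Finset V) (hy : y = T'.biUnion bag)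
    (u u' : ι) (hu : u ∉ T')
    (hadj : T.Adj u u') (q : T.Walk u' r)
    (hpath : (SimpleGraph.Walk.cons hadj q).IsPath) :
    ∀ x ∈ bag u, ¬ (x ∉ y ∧ ∀ w ∈ q.support, x ∉ bag w) → x ∈ bag u' := by
  classical
  intro x hx hn
  obtain ⟨hT, hconn, -, -⟩ := hGHD
  have hq := (SimpleGraph.Walk.cons_isPath_iff hadj q).1 hpath
  have key : ∃ w, x ∈ bag w ∧ ∃ p : T.Walk u' w, u ∉ p.support := by
    by_cases hxy : x ∈ y
    · rw [hy, Finset.mem_biUnion] at hxy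
      obtain ⟨w, hw, hxw⟩ := hxy
      obtain ⟨p, hp⟩ := exists_walk_of_induce T _ hconnex r w hroot hw
      refine ⟨w, hxw, q.append p, ?_⟩
      rw [SimpleGraph.Walk.mem_support_append_iff]
      rintro (h | h)
      · exact hq.2 h
      · exact hu (by simpa using hp u h)
    · have : ∃ w ∈ q.support, x ∈ bag w := by
        by_contra hc
        push Not at hc
        exact hn ⟨hxy, hc⟩
      obtain ⟨w, hw, hxw⟩ := this
      exact ⟨w, hxw, q.takeUntil w hw,
        fun h => hq.2 (q.support_takeUntil_subset_support hw h)⟩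
  obtain ⟨w, hxw, p, hp⟩ := key
  obtain ⟨s, hs⟩ := exists_walk_of_induce T _ (hconn x) u w hx hxw
  have h1 : (SimpleGraph.Walk.cons hadj p.bypass).IsPath :=
    (SimpleGraph.Walk.cons_isPath_iff hadj _).2
      ⟨p.bypass_isPath, fun h => hp (p.support_bypass_subset_support h)⟩
  have h2 := hT.existsUnique_path u w |>.unique h1 s.bypass_isPath
  have h3 : u' ∈ s.bypass.support := by
    rw [← h2]
    simp
  exact hs u' (s.support_bypass_subset_support h3)
end

section
/- Let Q = (V,E) be an acyclic, reduced join that is not hierarchical. Then there exist three distinct hyperedges e₁, e₂, e₃ ∈ E and four distinct attributes x₁, x₂, x₃, x₄ such that x₁ ∈ e₁ ∖ (e₂ ∪ e₃), x₂ ∈ (e₁ ∩ e₂) ∖ e₃, x₃ ∈ (e₂ ∩ e₃) ∖ e₁, x₄ ∈ e₃ ∖ (e₁ ∪ e₂), and moreover no hyperedge e ∈ E satisfies {x₁, x₂, x₃} ⊆ e and no hyperedge e ∈ E satisfies {x₂, x₃, x₄} ⊆ e. -/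
open Finset

lemma key16 {V : Type} [DecidableEq V] (E : Finset (Finset V))
    (T : SimpleGraph {e // e ∈ E}) (hT : IsJoinTree E T)
    (hred : ∀ e ∈ E, ∀ e' ∈ E, e ⊆ e' → e = e') (x y : V) (a b : Finset V)
    (ha : a ∈ E) (hb : b ∈ E) (hxa : x ∈ a) (hya : y ∉ a) (hxb : x ∈ b) (hyb : y ∈ b) :
    ∃ e ∈ E, x ∈ e ∧ y ∉ e ∧ ∃ z ∈ e, ∀ h ∈ E, z ∈ h → y ∉ h := by
  obtain ⟨hT, hc⟩ := hT
  obtain ⟨w⟩ := hc x ⟨⟨a, ha⟩, hxa⟩ ⟨⟨b, hb⟩, hxb⟩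
  obtain ⟨d, -, hd1, hd2⟩ := w.exists_boundary_dart {e | y ∉ e.1.1} hya (fun h => h hyb)
  obtain ⟨⟨⟨⟨e, he⟩, hxe⟩, ⟨⟨f, hf⟩, hxf⟩⟩, hadj⟩ := d
  have hye : y ∉ e := hd1
  have hyf : y ∈ f := by simpa using hd2
  have hadj : T.Adj ⟨e, he⟩ ⟨f, hf⟩ := hadj
  refine ⟨e, he, hxe, hye, ?_⟩
  have hnot : ¬ e ⊆ f := fun h => hye (hred e he f hf h ▸ hyf)
  obtain ⟨z, hze, hzf⟩ := Finset.not_subset.1 hnot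
  refine ⟨z, hze, fun h hh hzh hyh => ?_⟩
  have hbr := SimpleGraph.isAcyclic_iff_forall_adj_isBridge.1 hT.IsAcyclic hadj
  rw [SimpleGraph.isBridge_iff] at hbr
  have lift : ∀ (v : V) (p q : {e // e ∈ E}), v ∈ p.1 → v ∈ q.1 → (v ∉ e ∨ v ∉ f) →
      (T.deleteEdges {s(⟨e, he⟩, ⟨f, hf⟩)}).Reachable p q := by
    intro v p q hp hq hv
    refine (hc v ⟨p, hp⟩ ⟨q, hq⟩).map (G' := T.deleteEdges {s(⟨e, he⟩, ⟨f, hf⟩)})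
      ⟨fun t => t.1, ?_⟩
    rintro ⟨s, hs⟩ ⟨t, ht⟩ hst
    have hst : T.Adj s t := hst
    rw [SimpleGraph.deleteEdges_adj]
    refine ⟨hst, fun hmem => ?_⟩
    simp only [Set.mem_singleton_iff, Sym2.eq_iff] at hmem
    simp only [Set.mem_setOf_eq] at hs ht
    rcases hmem with ⟨rfl, rfl⟩ | ⟨rfl, rfl⟩ <;> tauto
  exact hbr ((lift z _ ⟨h, hh⟩ hze hzh (Or.inr hzf)).trans
    (lift y ⟨h, hh⟩ _ hyh hyf (Or.inl hye)))

theorem stmt16 {V : Type} [Fintype V] [DecidableEq V] (E : Finset (Finset V))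
    (hcover : ∀ v : V, ∃ e ∈ E, v ∈ e) (hacyc : AcyclicHG E)
    (hred : ∀ e ∈ E, ∀ e' ∈ E, e ⊆ e' → e = e')
    (hnonhier : ¬ Hierarchical E) :
    ∃ e₁ ∈ E, ∃ e₂ ∈ E, ∃ e₃ ∈ E, e₁ ≠ e₂ ∧ e₁ ≠ e₃ ∧ e₂ ≠ e₃ ∧
      ∃ x₁ x₂ x₃ x₄ : V,
        x₁ ≠ x₂ ∧ x₁ ≠ x₃ ∧ x₁ ≠ x₄ ∧ x₂ ≠ x₃ ∧ x₂ ≠ x₄ ∧ x₃ ≠ x₄ ∧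
        (x₁ ∈ e₁ ∧ x₁ ∉ e₂ ∧ x₁ ∉ e₃) ∧
        (x₂ ∈ e₁ ∧ x₂ ∈ e₂ ∧ x₂ ∉ e₃) ∧
        (x₃ ∈ e₂ ∧ x₃ ∈ e₃ ∧ x₃ ∉ e₁) ∧
        (x₄ ∈ e₃ ∧ x₄ ∉ e₁ ∧ x₄ ∉ e₂) ∧
        (∀ e ∈ E, ¬(x₁ ∈ e ∧ x₂ ∈ e ∧ x₃ ∈ e)) ∧
        (∀ e ∈ E, ¬(x₂ ∈ e ∧ x₃ ∈ e ∧ x₄ ∈ e)) := by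
  obtain ⟨T, hT⟩ := hacyc
  simp only [Hierarchical, not_forall, not_or] at hnonhier
  obtain ⟨x, y, h1, h2, h3⟩ := hnonhier
  obtain ⟨a, ha, ha'⟩ := Finset.not_subset.1 h1
  obtain ⟨c, hc, hc'⟩ := Finset.not_subset.1 h2
  obtain ⟨b, hb⟩ := Finset.nonempty_iff_ne_empty.2 h3
  simp only [edgesWith, Finset.mem_filter, Finset.mem_inter, not_and] at ha ha' hc hc' hb
  obtain ⟨e, he, hxe, hye, z, hz, hz'⟩ := key16 E T hT hred x y a b ha.1 hb.1.1 ha.2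
    (ha' ha.1) hb.1.2 hb.2.2
  obtain ⟨g, hg, hyg, hxg, u, hu, hu'⟩ := key16 E T hT hred y x c b hc.1 hb.1.1 hc.2
    (hc' hc.1) hb.2.2 hb.1.2
  have hbE := hb.1.1
  have hxb := hb.1.2
  have hyb := hb.2.2
  have n1 : z ∉ b := fun h => hz' b hbE h hyb
  have n2 : z ∉ g := fun h => hz' g hg h hyg
  have n3 : u ∉ b := fun h => hu' b hbE h hxb
  have n4 : u ∉ e := fun h => hu' e he h hxe
  refine ⟨e, he, b, hbE, g, hg, ?_, ?_, ?_, z, x, y, u, ?_, ?_, ?_, ?_, ?_, ?_,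
    ⟨hz, n1, n2⟩, ⟨hxe, hxb, hxg⟩, ⟨hyb, hyg, hye⟩, ⟨hu, n4, n3⟩,
    fun k hk h => hz' k hk h.1 h.2.2, fun k hk h => hu' k hk h.2.2 h.1⟩ <;>
  · rintro rfl
    contradiction
end

section
/- Let Q = (V,E) be an acyclic join, and suppose there exist three distinct hyperedges e₁, e₂, e₃ ∈ E and four distinct attributes x₁, x₂, x₃, x₄ such that x₁ ∈ e₁ ∖ (e₂ ∪ e₃), x₂ ∈ (e₁ ∩ e₂) ∖ e₃, x₃ ∈ (e₂ ∩ e₃) ∖ e₁, x₄ ∈ e₃ ∖ (e₁ ∪ e₂), no hyperedge of E contains {x₁, x₂, x₃}, and no hyperedge of E contains {x₂, x₃, x₄}. Then no hyperedge of E contains {x₁, x₃}, no hyperedge contains {x₁, x₄}, and no hyperedge contains {x₂, x₄}; hence (x₁, x₂, x₃, x₄) is a minimal path of length 3 in Q. -/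
open Finset

def WConn {N : Type} (T : SimpleGraph N) (S : Set N) : Prop :=
  ∀ x ∈ S, ∀ y ∈ S, ∃ w : T.Walk x y, ∀ z ∈ w.support, z ∈ S

theorem WConn.of_induce {N : Type} {T : SimpleGraph N} {S : Set N}
    (h : (T.induce S).Preconnected) : WConn T S := by
  intro x hx y hy
  obtain ⟨w⟩ := h ⟨x, hx⟩ ⟨y, hy⟩
  have key : ∀ (a b : S) (_ : (T.induce S).Walk a b),
      ∃ w : T.Walk a.1 b.1, ∀ z ∈ w.support, z ∈ S := by
    intro a b p
    induction p with
    | @nil u => exact ⟨SimpleGraph.Walk.nil, by simp⟩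
    | @cons u v t hadj p ih =>
      obtain ⟨w, hw⟩ := ih
      have hadj' : T.Adj u.1 v.1 := hadj
      refine ⟨SimpleGraph.Walk.cons hadj' w, ?_⟩
      intro z hz
      rw [SimpleGraph.Walk.support_cons, List.mem_cons] at hz
      rcases hz with rfl | hz
      · exact u.2
      · exact hw z hz
  exact key _ _ w

theorem WConn.union {N : Type} {T : SimpleGraph N} {S R : Set N}
    (hS : WConn T S) (hR : WConn T R) (e : N) (heS : e ∈ S) (heR : e ∈ R) :
    WConn T (S ∪ R) := by
  have key : ∀ x ∈ S ∪ R, ∃ w : T.Walk x e, ∀ z ∈ w.support, z ∈ S ∪ R := by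
    rintro x (hx | hx)
    · obtain ⟨w, hw⟩ := hS x hx e heS
      exact ⟨w, fun z hz => Or.inl (hw z hz)⟩
    · obtain ⟨w, hw⟩ := hR x hx e heR
      exact ⟨w, fun z hz => Or.inr (hw z hz)⟩
  intro x hx y hy
  obtain ⟨w, hw⟩ := key x hx
  obtain ⟨u, hu⟩ := key y hy
  refine ⟨w.append u.reverse, ?_⟩
  intro z hz
  rw [SimpleGraph.Walk.mem_support_append_iff, SimpleGraph.Walk.support_reverse,
    List.mem_reverse] at hz
  exact hz.elim (hw z) (hu z)

theorem walk_cross {N : Type} {T : SimpleGraph N} {B C : Set N} {b c : N} (p : T.Walk b c)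
    (hb : b ∈ C) (hc : c ∈ B)
    (h : ∀ u v, s(u, v) ∈ p.edges → (u ∈ B ∧ v ∈ B) ∨ (u ∈ C ∧ v ∈ C)) :
    ∃ z ∈ p.support, z ∈ B ∧ z ∈ C := by
  induction p with
  | nil => exact ⟨_, by simp, hc, hb⟩
  | @cons u v w a p ih =>
    by_cases hu : u ∈ B
    · exact ⟨u, by simp, hu, hb⟩
    · have hv : v ∈ C := by
        rcases h u v (by simp) with h' | h'
        · exact absurd h'.1 hu
        · exact h'.2
      obtain ⟨z, hz, hz'⟩ := ih hv hc (fun x y hxy => h x y (by simp [hxy]))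
      exact ⟨z, by simp [hz], hz'⟩

theorem helly3 {N : Type} {T : SimpleGraph N} (hT : T.IsAcyclic) {A B C : Set N}
    (hA : WConn T A) (hB : WConn T B) (hC : WConn T C) (a b c : N)
    (haB : a ∈ B) (haC : a ∈ C) (hbA : b ∈ A) (hbC : b ∈ C) (hcA : c ∈ A) (hcB : c ∈ B) :
    ∃ z, z ∈ A ∧ z ∈ B ∧ z ∈ C := by
  classical
  obtain ⟨p, hp⟩ := hA b hbA c hcA
  obtain ⟨q, hq⟩ := hC b hbC a haC
  obtain ⟨r, hr⟩ := hB a haB c hcB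
  have heq : p.bypass = (q.append r).bypass :=
    congrArg Subtype.val (hT.path_unique ⟨_, p.bypass_isPath⟩ ⟨_, (q.append r).bypass_isPath⟩)
  obtain ⟨z, hz, hz'⟩ := walk_cross (B := B) (C := C) p.bypass hbC hcB (by
    intro u v huv
    rw [heq] at huv
    have h2 := (q.append r).edges_bypass_subset_edges huv
    rw [SimpleGraph.Walk.edges_append, List.mem_append] at h2
    rcases h2 with h2 | h2
    · exact Or.inr ⟨hq _ (q.fst_mem_support_of_mem_edges h2),
        hq _ (q.snd_mem_support_of_mem_edges h2)⟩
    · exact Or.inl ⟨hr _ (r.fst_mem_support_of_mem_edges h2),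
        hr _ (r.snd_mem_support_of_mem_edges h2)⟩)
  exact ⟨z, hp z (p.support_bypass_subset_support hz), hz'⟩

theorem stmt17 {V : Type} [Fintype V] [DecidableEq V] (E : Finset (Finset V))
    (hcover : ∀ v : V, ∃ e ∈ E, v ∈ e) (hacyc : AcyclicHG E)
    (e₁ e₂ e₃ : Finset V) (he₁ : e₁ ∈ E) (he₂ : e₂ ∈ E) (he₃ : e₃ ∈ E)
    (hne₁₂ : e₁ ≠ e₂) (hne₁₃ : e₁ ≠ e₃) (hne₂₃ : e₂ ≠ e₃)
    (x₁ x₂ x₃ x₄ : V)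
    (hx₁₂ : x₁ ≠ x₂) (hx₁₃ : x₁ ≠ x₃) (hx₁₄ : x₁ ≠ x₄)
    (hx₂₃ : x₂ ≠ x₃) (hx₂₄ : x₂ ≠ x₄) (hx₃₄ : x₃ ≠ x₄)
    (h1 : x₁ ∈ e₁ ∧ x₁ ∉ e₂ ∧ x₁ ∉ e₃)
    (h2 : x₂ ∈ e₁ ∧ x₂ ∈ e₂ ∧ x₂ ∉ e₃)
    (h3 : x₃ ∈ e₂ ∧ x₃ ∈ e₃ ∧ x₃ ∉ e₁)
    (h4 : x₄ ∈ e₃ ∧ x₄ ∉ e₁ ∧ x₄ ∉ e₂)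
    (h123 : ∀ e ∈ E, ¬(x₁ ∈ e ∧ x₂ ∈ e ∧ x₃ ∈ e))
    (h234 : ∀ e ∈ E, ¬(x₂ ∈ e ∧ x₃ ∈ e ∧ x₄ ∈ e)) :
    (∀ e ∈ E, ¬(x₁ ∈ e ∧ x₃ ∈ e)) ∧ (∀ e ∈ E, ¬(x₁ ∈ e ∧ x₄ ∈ e)) ∧
      (∀ e ∈ E, ¬(x₂ ∈ e ∧ x₄ ∈ e)) := by
  obtain ⟨T, hT, hpre⟩ := hacyc
  have hW : ∀ v : V, WConn T {e : {e // e ∈ E} | v ∈ e.1} := fun v => WConn.of_induce (hpre v)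
  have hac := hT.isAcyclic
  refine ⟨?_, ?_, ?_⟩
  · rintro e he ⟨ha, hb⟩
    obtain ⟨z, hz1, hz2, hz3⟩ := helly3 hac (hW x₁) (hW x₂) (hW x₃) ⟨e₂, he₂⟩ ⟨e, he⟩ ⟨e₁, he₁⟩
      h2.2.1 h3.1 ha hb h1.1 h2.1
    exact h123 z.1 z.2 ⟨hz1, hz2, hz3⟩
  · rintro e he ⟨ha, hb⟩
    obtain ⟨z, hz1, hz2, hz3⟩ := helly3 hac ((hW x₁).union (hW x₄) ⟨e, he⟩ ha hb) (hW x₂) (hW x₃)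
      ⟨e₂, he₂⟩ ⟨e₃, he₃⟩ ⟨e₁, he₁⟩ h2.2.1 h3.1 (Or.inr h4.1) h3.2.1 (Or.inl h1.1) h2.1
    rcases hz1 with hz1 | hz1
    · exact h123 z.1 z.2 ⟨hz1, hz2, hz3⟩
    · exact h234 z.1 z.2 ⟨hz2, hz3, hz1⟩
  · rintro e he ⟨ha, hb⟩
    obtain ⟨z, hz1, hz2, hz3⟩ := helly3 hac (hW x₂) (hW x₃) (hW x₄) ⟨e₃, he₃⟩ ⟨e, he⟩ ⟨e₂, he₂⟩
      h3.2.1 h4.1 ha hb h2.2.1 h3.1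
    exact h234 z.1 z.2 ⟨hz1, hz2, hz3⟩
end
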